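/- Let X ⊂ P^r be an integral non-degenerate variety of dimension n ≥ 2 over an algebraically closed field of characteristic zero with ρ''(X) ≥ 2a where a := (r+1)/(n+1) ∈ ℤ, a ≥ 2. Let S ⊂ X be a general set of a−1 (smooth) points and V := ⟨∪_{p∈S} T_p X⟩, of dimension (a−1)(n+1) − 1. Then: (i) no point o ∈ X ∖ S lies in V; (ii) the linear projection from V restricts to an injective morphism X ∖ S → P^n. -/

import Mathlib

open MvPolynomial

noncomputable section

namespace Dep

variable (K : Type) [Field K]

/-- `PS K n` is the projective space of lines in `K^n`, i.e. `ℙ^{n-1}`. -/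
abbrev PS (n : ℕ) := Projectivization K (Fin n → K)

/-- The projective zero locus of a (homogeneous) polynomial. -/
def zeros {n : ℕ} (f : MvPolynomial (Fin n) K) : Set (PS K n) :=
  {p | ∀ v : Fin n → K, ∀ hv : v ≠ 0, Projectivization.mk K v hv = p → eval v f = 0}

/-- Zariski-closed subsets of projective space: common zero loci of families of
homogeneous polynomials. -/
def IsZClosed {n : ℕ} (X : Set (PS K n)) : Prop :=
  ∃ F : Set (MvPolynomial (Fin n) K), (∀ f ∈ F, ∃ d, f.IsHomogeneous d) ∧
    X = ⋂ f ∈ F, zeros K f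

/-- Irreducible closed subsets. -/
def IsIrredClosed {n : ℕ} (X : Set (PS K n)) : Prop :=
  X.Nonempty ∧ IsZClosed K X ∧
    ∀ C₁ C₂ : Set (PS K n), IsZClosed K C₁ → IsZClosed K C₂ → X ⊆ C₁ ∪ C₂ →
      X ⊆ C₁ ∨ X ⊆ C₂

/-- Zariski closure. -/
def zclosure {n : ℕ} (S : Set (PS K n)) : Set (PS K n) :=
  ⋂₀ {C | IsZClosed K C ∧ S ⊆ C}

/-- Dimension of a subset of projective space: the supremum of lengths of strict chains
of irreducible closed subsets contained in it. -/
def zdim {n : ℕ} (X : Set (PS K n)) : ℕ :=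
  sSup {m | ∃ C : Fin (m + 1) → Set (PS K n),
    (∀ i, IsIrredClosed K (C i) ∧ C i ⊆ X) ∧
    ∀ i j : Fin (m + 1), i < j → C i ⊂ C j}

/-- The linear subspace of `K^n` spanned by (representatives of) a set of projective points. -/
def projSpan {n : ℕ} (S : Set (PS K n)) : Submodule K (Fin n → K) :=
  Submodule.span K (Projectivization.rep '' S)

/-- The projective linear span of a set of projective points, as a set of points. -/
def spanSet {n : ℕ} (S : Set (PS K n)) : Set (PS K n) :=
  {p | p.rep ∈ projSpan K S}

/-- Non-degenerate: not contained in any hyperplane, i.e. the points span everything. -/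
def Nondeg {n : ℕ} (X : Set (PS K n)) : Prop := projSpan K X = ⊤

/-- An integral non-degenerate projective variety in `ℙ^{n-1}`. -/
def IsVariety {n : ℕ} (X : Set (PS K n)) : Prop :=
  IsIrredClosed K X ∧ Nondeg K X

/-- A finite set of projective points is linearly independent if its span has dimension
(as a vector subspace) equal to its cardinality. -/
def LinIndepSet {n : ℕ} (S : Finset (PS K n)) : Prop :=
  Module.finrank K (projSpan K (S : Set (PS K n))) = S.card

/-- `ρ'(X)`: the maximal `t > 0` such that every subset of `X` with at most `t` points is
linearly independent. -/
def rho' {n : ℕ} (X : Set (PS K n)) : ℕ :=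
  sSup {t | 0 < t ∧ ∀ S : Finset (PS K n), ↑S ⊆ X → S.card ≤ t → LinIndepSet K S}

/- ### Zero-dimensional subschemes, via homogeneous ideals -/

/-- A homogeneous ideal. -/
def IsHomogIdeal {n : ℕ} (I : Ideal (MvPolynomial (Fin n) K)) : Prop :=
  ∀ f ∈ I, ∀ d : ℕ, homogeneousComponent d f ∈ I

/-- The homogeneous vanishing ideal of a set of projective points. -/
def hVanish {n : ℕ} (S : Set (PS K n)) : Ideal (MvPolynomial (Fin n) K) :=
  Ideal.span {f | (∃ d, f.IsHomogeneous d) ∧ S ⊆ zeros K f}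

/-- The Hilbert function of (the subscheme defined by) a homogeneous ideal: the dimension of
the degree-`m` graded piece of the quotient ring. -/
def hilb {n : ℕ} (I : Ideal (MvPolynomial (Fin n) K)) (m : ℕ) : ℕ :=
  Module.finrank K (Submodule.map (Ideal.Quotient.mkₐ K I).toLinearMap
    (homogeneousSubmodule (Fin n) K m))

/-- The subscheme defined by `I` is zero-dimensional of degree `d`: the Hilbert function is
eventually constant, equal to `d`. -/
def SchemeDeg {n : ℕ} (I : Ideal (MvPolynomial (Fin n) K)) (d : ℕ) : Prop :=
  ∃ N, ∀ m ≥ N, hilb K I m = d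

/-- The subscheme defined by `I` lies in `X`. -/
def SubschemeOf {n : ℕ} (X : Set (PS K n)) (I : Ideal (MvPolynomial (Fin n) K)) : Prop :=
  hVanish K X ≤ I

/-- The degree-one part of a homogeneous ideal, i.e. the linear forms vanishing on the
corresponding subscheme. -/
def degOnePart {n : ℕ} (I : Ideal (MvPolynomial (Fin n) K)) :
    Submodule K (MvPolynomial (Fin n) K) :=
  homogeneousSubmodule (Fin n) K 1 ⊓ I.restrictScalars K

/-- A zero-dimensional subscheme of degree `d` of `ℙ^{n-1}` is linearly independent iff its
projective span has dimension `d - 1`, i.e. exactly `n - d` independent linear forms vanish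
on it. -/
def SchemeLinIndep {n : ℕ} (I : Ideal (MvPolynomial (Fin n) K)) (d : ℕ) : Prop :=
  Module.finrank K (degOnePart K I) = n - d

/-- The projective linear span of the subscheme defined by `I`: the common zero locus of the
linear forms in `I`. -/
def schemeSpan {n : ℕ} (I : Ideal (MvPolynomial (Fin n) K)) : Set (PS K n) :=
  {p | ∀ f ∈ I, f.IsHomogeneous 1 → p ∈ zeros K f}

/-- The set-theoretic zero locus of an ideal. -/
def idealZeros {n : ℕ} (I : Ideal (MvPolynomial (Fin n) K)) : Set (PS K n) :=
  {p | ∀ f ∈ I, ∀ m : ℕ, p ∈ zeros K (homogeneousComponent m f)}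

/-- The subscheme defined by `I` is reduced: `I` is the full vanishing ideal of its zero set. -/
def IsReducedScheme {n : ℕ} (I : Ideal (MvPolynomial (Fin n) K)) : Prop :=
  I = hVanish K (idealZeros K I)

/- ### Smoothability: flat limits of reduced finite subsets -/

/-- Specialisation of a one-parameter family of ideals at `c : K`. -/
def fiberAt {n : ℕ} (J : Ideal (MvPolynomial (Fin n) (Polynomial K))) (c : K) :
    Ideal (MvPolynomial (Fin n) K) :=
  Ideal.map (MvPolynomial.map (Polynomial.evalRingHom c)) J

/-- `Z` (given by `I`, of degree `d`) is smoothable in `X`: either `Z` is already a reduced set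
of `d` points of `X`, or `Z` is the flat limit at `0` of a one-parameter family whose general
member is a reduced set of `d` points of `X`.  Flatness over `K[t]` is encoded as
torsion-freeness of the quotient. -/
def SmoothableIn {n : ℕ} (X : Set (PS K n)) (I : Ideal (MvPolynomial (Fin n) K)) (d : ℕ) :
    Prop :=
  (∃ S : Finset (PS K n), ↑S ⊆ X ∧ S.card = d ∧ I = hVanish K (S : Set (PS K n))) ∨
  ∃ J : Ideal (MvPolynomial (Fin n) (Polynomial K)),
    (∀ f ∈ J, ∀ m : ℕ, homogeneousComponent m f ∈ J) ∧
    (∀ p : Polynomial K, p ≠ 0 → ∀ f, MvPolynomial.C p * f ∈ J → f ∈ J) ∧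
    fiberAt K J 0 = I ∧
    ∃ E : Set K, E.Finite ∧ ∀ c : K, c ∉ E →
      ∃ S : Finset (PS K n), ↑S ⊆ X ∧ S.card = d ∧
        fiberAt K J c = hVanish K (S : Set (PS K n))

/-- `ρ''(X)`: the maximal `t > 0` such that every zero-dimensional subscheme of `X` of degree
at most `t` which is smoothable in `X` is linearly independent. -/
def rho'' {n : ℕ} (X : Set (PS K n)) : ℕ :=
  sSup {t | 0 < t ∧ ∀ (I : Ideal (MvPolynomial (Fin n) K)) (d : ℕ),
    IsHomogIdeal K I → SubschemeOf K X I → SchemeDeg K I d → SmoothableIn K X I d →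
    d ≤ t → SchemeLinIndep K I d}

/-- `ρ(X)`: the maximal `t > 0` such that every zero-dimensional subscheme of `X` of degree
at most `t` is linearly independent. -/
def rho {n : ℕ} (X : Set (PS K n)) : ℕ :=
  sSup {t | 0 < t ∧ ∀ (I : Ideal (MvPolynomial (Fin n) K)) (d : ℕ),
    IsHomogIdeal K I → SubschemeOf K X I → SchemeDeg K I d →
    d ≤ t → SchemeLinIndep K I d}

/- ### Ranks and secant varieties -/

/-- The `X`-rank of a point `q`. -/
def Xrank {n : ℕ} (X : Set (PS K n)) (q : PS K n) : ℕ :=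
  sInf {t | 0 < t ∧ ∃ S : Finset (PS K n), ↑S ⊆ X ∧ S.card = t ∧ q ∈ spanSet K ↑S}

/-- `𝒮(X,q)`: the set of finite subsets of `X` of minimal cardinality whose span contains `q`. -/
def Sq {n : ℕ} (X : Set (PS K n)) (q : PS K n) : Set (Finset (PS K n)) :=
  {S | ↑S ⊆ X ∧ S.card = Xrank K X q ∧ q ∈ spanSet K ↑S}

/-- The `k`-th secant variety of `X`. -/
def secant {n : ℕ} (X : Set (PS K n)) (k : ℕ) : Set (PS K n) :=
  zclosure K (⋃ S ∈ {S : Finset (PS K n) | ↑S ⊆ X ∧ S.card = k}, spanSet K (S : Set (PS K n)))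

/-- The generic `X`-rank: the least `k` with `σ_k(X) = ℙ^{n-1}`. -/
def genRank {n : ℕ} (X : Set (PS K n)) : ℕ :=
  sInf {k | 0 < k ∧ secant K X k = Set.univ}

/-- The border `X`-rank of a point. -/
def borderRank {n : ℕ} (X : Set (PS K n)) (q : PS K n) : ℕ :=
  sInf {k | 0 < k ∧ q ∈ secant K X k}

/-- `X ⊆ ℙ^{m-1}` of dimension `dX` is not defective: every secant variety has the expected
dimension. -/
def NotDefective {m : ℕ} (X : Set (PS K m)) (dX : ℕ) : Prop :=
  ∀ k : ℕ, 0 < k → zdim K (secant K X k) = min (m - 1) (k * (dX + 1) - 1)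

/- ### Rational normal curves -/

/-- `X ⊆ ℙ^{n-1}` is a rational normal curve: up to a linear change of coordinates it is the
image of `ℙ^1` under the degree-`(n-1)` Veronese map. -/
def IsRNC {n : ℕ} (X : Set (PS K n)) : Prop :=
  ∃ g : (Fin n → K) ≃ₗ[K] (Fin n → K),
    X = {p | ∃ v : Fin 2 → K,
      ∃ hv : g (fun i => v 0 ^ (i : ℕ) * v 1 ^ (n - 1 - (i : ℕ))) ≠ 0,
      p = Projectivization.mk K (g (fun i => v 0 ^ (i : ℕ) * v 1 ^ (n - 1 - (i : ℕ)))) hv}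

/- ### Linear projections and linear normality -/

/-- The pull-back map on polynomials induced by a linear map `π : K^{n+1} → K^n`. -/
def pullback {n m : ℕ} (π : (Fin m → K) →ₗ[K] (Fin n → K)) :
    MvPolynomial (Fin n) K →ₐ[K] MvPolynomial (Fin m) K :=
  aeval (fun i => ∑ j : Fin m, MvPolynomial.C (π (Pi.single j 1) i) * MvPolynomial.X j)

/-- The image of a set of points under the projection induced by `π`. -/
def projImage {n m : ℕ} (π : (Fin m → K) →ₗ[K] (Fin n → K)) (Y : Set (PS K m)) :
    Set (PS K n) :=
  {q | ∃ p ∈ Y, ∃ h : π p.rep ≠ 0, q = Projectivization.mk K (π p.rep) h}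

/-- The linear projection from the point `o` (encoded by the linear map `π` with kernel the
line of `o`) restricts to an embedding of `Y`: `o ∉ Y` and `o` lies on no secant or tangent
line of `Y`, i.e. on the span of no degree-2 subscheme of `Y`. -/
def EmbedsFrom {n : ℕ} (π : (Fin (n + 1) → K) →ₗ[K] (Fin n → K)) (o : PS K (n + 1))
    (Y : Set (PS K (n + 1))) : Prop :=
  Function.Surjective π ∧
  LinearMap.ker π = Submodule.span K {o.rep} ∧ o ∉ Y ∧
  ∀ I : Ideal (MvPolynomial (Fin (n + 1)) K),
    IsHomogIdeal K I → SubschemeOf K Y I → SchemeDeg K I 2 → o ∉ schemeSpan K I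

/-- `X ⊆ ℙ^{n-1}` is linearly normal: it is not an isomorphic linear projection of a
non-degenerate variety in `ℙ^n`. -/
def LinearlyNormal {n : ℕ} (X : Set (PS K n)) : Prop :=
  ¬ ∃ (Y : Set (PS K (n + 1))) (o : PS K (n + 1))
      (π : (Fin (n + 1) → K) →ₗ[K] (Fin n → K)),
      IsVariety K Y ∧ EmbedsFrom K π o Y ∧ projImage K π Y = X

/- ### Tangent spaces and smooth points -/

/-- The (affine cone over the) embedded tangent space of `X` at `p`: the common kernel of the
differentials at `p` of all elements of the vanishing ideal of `X`. -/
def tangentSub {n : ℕ} (X : Set (PS K n)) (p : PS K n) : Submodule K (Fin n → K) :=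
  ⨅ f ∈ hVanish K X, LinearMap.ker
    (∑ j : Fin n, eval p.rep (pderiv j f) • (LinearMap.proj j : (Fin n → K) →ₗ[K] K))

/-- `p` is a smooth point of `X`. -/
def SmoothAt {n : ℕ} (X : Set (PS K n)) (p : PS K n) : Prop :=
  p ∈ X ∧ Module.finrank K (tangentSub K X p) = zdim K X + 1

/-- A smooth integral non-degenerate projective variety. -/
def SmoothVariety {n : ℕ} (X : Set (PS K n)) : Prop :=
  IsVariety K X ∧ ∀ p ∈ X, SmoothAt K X p

lemma trdeg_quot_lt {k R : Type} [Field k] [CommRing R] [IsDomain R] [Algebra k R]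
    (p : Ideal R) [p.IsPrime] (hp : p ≠ ⊥) :
    Algebra.trdeg k (R ⧸ p) + 1 ≤ Algebra.trdeg k R := by
  have : FaithfulSMul k (R ⧸ p) :=
    (faithfulSMul_iff_algebraMap_injective k (R ⧸ p)).2 (algebraMap k (R ⧸ p)).injective
  obtain ⟨s, hs⟩ := exists_isTranscendenceBasis k (R ⧸ p)
  rw [← hs.cardinalMk_eq_trdeg]
  obtain ⟨x, hxp, hx0⟩ := Submodule.exists_mem_ne_zero_of_ne_bot hp
  have hsurj : Function.Surjective (Ideal.Quotient.mkₐ k p) := Ideal.Quotient.mkₐ_surjective k p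
  let y : s → R := fun a => Function.surjInv hsurj a.1
  have hy : ∀ a, Ideal.Quotient.mkₐ k p (y a) = a.1 := fun a => Function.surjInv_eq hsurj _
  have hcomp : (Ideal.Quotient.mkₐ k p) ∘ y = ((↑) : s → R ⧸ p) := funext hy
  have hyi : AlgebraicIndependent k y := by
    have := hs.1
    rw [← hcomp] at this
    exact this.of_comp _
  have key : AlgebraicIndependent k (fun o : Option s => o.elim x y) := by
    rw [hyi.option_iff_transcendental]
    rw [transcendental_iff]
    intro P hP
    by_contra hP0
    -- divide by powers of X
    obtain ⟨e, Q, hQ, hQ0⟩ : ∃ e, ∃ Q : Polynomial (Algebra.adjoin k (Set.range y)),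
        P = Polynomial.X ^ e * Q ∧ Q.coeff 0 ≠ 0 := by
      obtain ⟨Q, hPQ, hnd⟩ := Polynomial.exists_eq_pow_rootMultiplicity_mul_and_not_dvd P hP0 0
      refine ⟨P.rootMultiplicity 0, Q, by simpa using hPQ, ?_⟩
      rw [ne_eq, ← Polynomial.X_dvd_iff]
      simpa using hnd
    rw [hQ, map_mul, map_pow, Polynomial.aeval_X] at hP
    have hQx : Polynomial.aeval x Q = 0 := by
      rcases mul_eq_zero.1 hP with h | h
      · exact absurd h (pow_ne_zero e hx0)
      · exact h
    have hmem : ((Q.coeff 0 : Algebra.adjoin k (Set.range y)) : R) ∈ p := by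
      rw [Polynomial.aeval_eq_sum_range, Finset.sum_range_succ'] at hQx
      have : ((Q.coeff 0 : Algebra.adjoin k (Set.range y)) : R)
          = - ∑ i ∈ Finset.range Q.natDegree, Q.coeff (i+1) • x ^ (i+1) := by
        rw [eq_neg_iff_add_eq_zero, add_comm]
        simpa [Algebra.smul_def] using hQx
      rw [this]
      refine p.neg_mem (p.sum_mem fun i _ => ?_)
      rw [Algebra.smul_def, pow_succ]
      exact p.mul_mem_left _ (p.mul_mem_left _ hxp)
    obtain ⟨G, hG⟩ : ∃ G, (aeval y).toRingHom G
        = ((Q.coeff 0 : Algebra.adjoin k (Set.range y)) : R) := by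
      have hc := (Q.coeff 0).2
      generalize ((Q.coeff 0 : Algebra.adjoin k (Set.range y)) : R) = z at hc
      rw [Algebra.adjoin_range_eq_range_aeval] at hc
      exact hc
    have h0 : aeval ((↑) : s → R ⧸ p) G = 0 := by
      rw [← hcomp]
      have : aeval ((Ideal.Quotient.mkₐ k p) ∘ y) G = Ideal.Quotient.mkₐ k p (aeval y G) := by
        exact (AlgHom.congr_fun (MvPolynomial.comp_aeval (f := y) (φ := Ideal.Quotient.mkₐ k p)) G).symm
      rw [this]
      change Ideal.Quotient.mkₐ k p ((aeval y).toRingHom G) = 0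
      rw [show (aeval y).toRingHom G = ((Q.coeff 0 : Algebra.adjoin k (Set.range y)) : R) from hG]
      exact Ideal.Quotient.eq_zero_iff_mem.2 hmem
    have hG0 : G = 0 := by
      have := hs.1
      rw [algebraicIndependent_iff] at this
      exact this G h0
    apply hQ0
    apply Subtype.ext
    rw [← hG, hG0]; simp
  have := key.cardinalMk_le_trdeg
  simpa using this

lemma trdeg_le_of_alg {k A B : Type} [Field k] [CommRing A] [IsDomain A] [CommRing B] [IsDomain B]
    [Algebra k A] [Algebra k B] [Algebra A B] [IsScalarTower k A B]
    [FaithfulSMul A B] [Algebra.IsAlgebraic A B] :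
    Algebra.trdeg k B ≤ Algebra.trdeg k A := by
  have h := trdeg_add_eq k A (A := B)
  rw [_root_.trdeg_eq_zero (R := A) (A := B), add_zero] at h
  exact h.ge

/-- A quotient of a polynomial ring by an irreducible element loses at most one dimension. -/
lemma trdeg_hypersurface {k : Type} [Field k] {M : ℕ} (c : MvPolynomial (Fin M) k)
    (hc : Irreducible c) :
    (M : Cardinal) ≤ Algebra.trdeg k (MvPolynomial (Fin M) k ⧸ Ideal.span {c}) + 1 := by
  -- some variable occurs
  obtain ⟨i, hi⟩ : ∃ i, i ∈ c.vars := by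
    by_contra h
    push Not at h
    have hv : c.vars = ∅ := Finset.eq_empty_of_forall_notMem h
    rw [vars_eq_empty_iff_eq_C] at hv
    have h0 : c.coeff 0 ≠ 0 := by
      intro h0
      rw [h0] at hv
      exact hc.ne_zero (by simpa using hv)
    apply hc.not_isUnit
    rw [hv]
    exact (isUnit_iff_ne_zero.2 h0).map C
  have key : AlgebraicIndependent k
      (fun j : {j : Fin M // j ≠ i} => Ideal.Quotient.mkₐ k (Ideal.span {c}) (X j.1)) := by
    rw [algebraicIndependent_iff]
    intro P hP
    have h1 : (Ideal.Quotient.mkₐ k (Ideal.span {c})) (rename Subtype.val P) = 0 := by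
      rw [← hP, rename_eq_aeval, ← MvPolynomial.comp_aeval]; rfl
    have h2 : c ∣ rename Subtype.val P := by
      rw [← Ideal.mem_span_singleton]
      exact Ideal.Quotient.eq_zero_iff_mem.1 h1
    by_contra hP0
    have hr : rename Subtype.val P ≠ 0 := fun h =>
      hP0 (rename_injective _ Subtype.val_injective (by simpa using h))
    obtain ⟨d, hd⟩ := h2
    have hd0 : d ≠ 0 := by rintro rfl; simp at hd; exact hr (by simpa using hd)
    have hdeg : (rename Subtype.val P).degreeOf i = c.degreeOf i + d.degreeOf i := by
      rw [hd, degreeOf_mul_eq hc.ne_zero hd0]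
    have hz : (rename (Subtype.val : {j : Fin M // j ≠ i} → Fin M) P).degreeOf i = 0 := by
      by_contra hne
      have : i ∈ (rename (Subtype.val : {j : Fin M // j ≠ i} → Fin M) P).vars := by
        exact mem_vars_iff_degreeOf_ne_zero.2 hne
      have := vars_rename _ _ this
      simp at this
    have hcpos : 0 < c.degreeOf i := Nat.pos_of_ne_zero (mem_vars_iff_degreeOf_ne_zero.1 hi)
    omega
  have h := key.cardinalMk_le_trdeg
  have hcard : Cardinal.mk {j : Fin M // j ≠ i} = ((M - 1 : ℕ) : Cardinal) := by
    rw [Cardinal.mk_fintype]; simp [Fintype.card_subtype_compl]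
  rw [hcard] at h
  calc (M : Cardinal) ≤ ((M - 1 : ℕ) : Cardinal) + 1 := by norm_cast; omega
    _ ≤ _ := by gcongr

/-- Codimension one primes through a nonunit. -/
lemma exists_prime_codim_one {k B : Type} [Field k] [CommRing B] [IsDomain B] [Algebra k B]
    [Algebra.FiniteType k B] (b : B) (hb0 : b ≠ 0) (hbu : ¬ IsUnit b) :
    ∃ q : Ideal B, q.IsPrime ∧ b ∈ q ∧
      Algebra.trdeg k B ≤ Algebra.trdeg k (B ⧸ q) + 1 := by
  have : IsNoetherianRing B := Algebra.FiniteType.isNoetherianRing k B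
  obtain ⟨M, g, hginj, hgint⟩ := exists_integral_inj_algHom_of_fg k B
  letI : Algebra (MvPolynomial (Fin M) k) B := g.toRingHom.toAlgebra
  have hst : IsScalarTower k (MvPolynomial (Fin M) k) B :=
    IsScalarTower.of_algebraMap_eq fun x => (g.commutes x).symm
  have : Algebra.IsIntegral (MvPolynomial (Fin M) k) B := ⟨hgint⟩
  have : FaithfulSMul (MvPolynomial (Fin M) k) B :=
    (faithfulSMul_iff_algebraMap_injective _ _).2 hginj
  have hM : Algebra.trdeg k B ≤ M := by
    have h1 := trdeg_le_of_alg (k := k) (A := MvPolynomial (Fin M) k) (B := B)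
    rw [MvPolynomial.trdeg_of_isDomain] at h1
    simpa using h1
  have hne : Ideal.span {b} ≠ ⊤ := by
    rwa [ne_eq, Ideal.span_singleton_eq_top]
  obtain ⟨q, hq⟩ := Ideal.nonempty_minimalPrimes hne
  have hqp : q.IsPrime := hq.1.1
  have hbq : b ∈ q := hq.1.2 (Ideal.mem_span_singleton_self b)
  have hht : q.height ≤ 1 := by
    exact Ideal.height_le_one_of_isPrincipal_of_mem_minimalPrimes (Ideal.span {b}) q hq
  set p := q.under (MvPolynomial (Fin M) k) with hp
  have hpp : p.IsPrime := inferInstance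
  have hp0 : p ≠ ⊥ := by
    intro h
    have : q = ⊥ := Ideal.eq_bot_of_comap_eq_bot (R := MvPolynomial (Fin M) k) h
    rw [this] at hbq
    exact hb0 (by simpa using hbq)
  obtain ⟨c, hcp, hc⟩ := Ideal.IsPrime.exists_mem_prime_of_ne_bot hpp hp0
  have hcprime : (Ideal.span {c}).IsPrime := (Ideal.span_singleton_prime hc.ne_zero).2 hc
  have hle : Ideal.span {c} ≤ p := by
    rw [Ideal.span_le]; simpa using hcp
  have hpc : p = Ideal.span {c} := by
    by_contra hne'
    have hlt : Ideal.span {c} < p := lt_of_le_of_ne hle (Ne.symm hne')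
    have : q.LiesOver p := ⟨rfl⟩
    obtain ⟨q', hq'lt, hq'p, hq'o⟩ := Ideal.exists_ideal_lt_liesOver_of_lt (p := Ideal.span {c}) q hlt
    have hq'0 : q' ≠ ⊥ := by
      rintro rfl
      have h1 := hq'o.over
      rw [Ideal.under_def, ← RingHom.ker_eq_comap_bot, (RingHom.injective_iff_ker_eq_bot (algebraMap (MvPolynomial (Fin M) k) B)).1 hginj] at h1
      exact hc.ne_zero (by simpa using h1)
    have hb : (⊥ : Ideal B).IsPrime := Ideal.isPrime_bot
    have h1 : (⊥ : Ideal B).height + 1 ≤ q'.height :=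
      Ideal.height_add_one_le_of_lt_of_isPrime (bot_lt_iff_ne_bot.2 hq'0)
    have h2 : q'.height + 1 ≤ q.height :=
      Ideal.height_add_one_le_of_lt_of_isPrime hq'lt
    have h3 : (2 : ℕ∞) ≤ 1 := by
      calc (2 : ℕ∞) = 0 + 1 + 1 := by norm_num
        _ ≤ (⊥ : Ideal B).height + 1 + 1 := by gcongr; simp
        _ ≤ q'.height + 1 := by gcongr
        _ ≤ q.height := h2
        _ ≤ 1 := hht
    exact absurd h3 (by decide)
  refine ⟨q, hqp, hbq, hM.trans ?_⟩
  refine (trdeg_hypersurface c hc.irreducible).trans ?_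
  rw [← hpc]
  gcongr
  exact trdeg_le_of_injective (Ideal.quotientMapₐ q g le_rfl)
    (Ideal.quotientMap_injective' (H := le_rfl) le_rfl)

lemma cRk_le_trdeg {k A D : Type} [Field k] [CommRing A] [Algebra k A]
    [CommRing D] [IsDomain D] [Algebra k D] [FaithfulSMul k D]
    (φ : A →ₐ[k] D) (s : Set D) (hs : s ⊆ Set.range φ) :
    (AlgebraicIndependent.matroid k D).cRk s ≤ Algebra.trdeg k A := by
  rw [Matroid.cRk_le_iff]
  intro I hI
  have hind : AlgebraicIndepOn k id I := AlgebraicIndependent.matroid_indep_iff.1 hI.indep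
  have hIs : I ⊆ s := hI.subset
  choose y hy using fun x : I => hs (hIs x.2)
  have hyi : AlgebraicIndependent k y := by
    have hc : φ ∘ y = fun x : I => id x.1 := funext hy
    have : AlgebraicIndependent k (φ ∘ y) := by rw [hc]; exact hind
    exact this.of_comp _
  exact hyi.cardinalMk_le_trdeg

lemma cRk_biUnion {k D : Type} [Field k]
    [CommRing D] [IsDomain D] [Algebra k D] [FaithfulSMul k D] {a : ℕ} (s : Fin a → Set D) (N : ℕ)
    (hN : ∀ i, (AlgebraicIndependent.matroid k D).cRk (s i) ≤ N) (T : Finset (Fin a)) :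
    (AlgebraicIndependent.matroid k D).cRk (⋃ i ∈ T, s i) ≤ (T.card * N : ℕ) := by
  classical
  induction T using Finset.induction_on with
  | empty => 
    refine (Matroid.cRk_le_cardinalMk _ _).trans ?_
    simp
  | insert i T hi ih =>
    rw [Finset.set_biUnion_insert, Finset.card_insert_of_notMem hi]
    have := Matroid.cRk_inter_add_cRk_union_le (M := AlgebraicIndependent.matroid k D) (X := s i)
      (Y := ⋃ i ∈ T, s i)
    refine (le_trans le_add_self this).trans ((add_le_add (hN i) ih).trans ?_)
    norm_cast
    rw [add_mul]; omega

lemma trdeg_pair {k D : Type} [Field k]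
    [CommRing D] [IsDomain D] [Algebra k D] [FaithfulSMul k D] {a m : ℕ} (y : Fin a → Fin m → D)
    (N : ℕ)
    (hgen : Algebra.adjoin k (⋃ i, Set.range (y i)) = ⊤)
    (hN : ∀ i, (AlgebraicIndependent.matroid k D).cRk (Set.range (y i)) ≤ N)
    (i j : Fin a) (hij : i ≠ j) (hmin : ∀ l l', y i l * y j l' = y i l' * y j l) :
    Algebra.trdeg k D ≤ (1 + (a - 1) * N : ℕ) := by
  classical
  rw [← AlgebraicIndependent.matroid_cRank_eq, ← Matroid.cRk_ground]
  set M := AlgebraicIndependent.matroid k D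
  have hcl : ∀ s : Set D, (∀ i l, IsAlgebraic (Algebra.adjoin k s) (y i l)) → M.cRk M.E ≤ M.cRk s := by
    intro s hs
    rw [← Matroid.cRk_closure M s]
    apply Matroid.cRk_le_of_subset
    rw [AlgebraicIndependent.matroid_closure_eq]
    have h1 : Algebra.adjoin k (⋃ i, Set.range (y i)) ≤
      (Subalgebra.algebraicClosure (Algebra.adjoin k s) D).restrictScalars k := by
      rw [Algebra.adjoin_le_iff]
      intro x hx
      simp only [Set.mem_iUnion, Set.mem_range] at hx
      obtain ⟨i, l, rfl⟩ := hx
      exact hs i l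
    rw [hgen] at h1
    intro x _
    exact h1 (Algebra.mem_top)
  have hmem : ∀ (s : Set D) (x : D), x ∈ s → IsAlgebraic (Algebra.adjoin k s) x := fun s x hx =>
    isAlgebraic_algebraMap (⟨x, Algebra.subset_adjoin hx⟩ : Algebra.adjoin k s)
  have hb : ∀ i : Fin a, M.cRk (⋃ i' ∈ Finset.univ.erase i, Set.range (y i')) ≤ ((a-1) * N : ℕ) := by
    intro i
    have := cRk_biUnion (fun i => Set.range (y i)) N hN (Finset.univ.erase i)
    rwa [Finset.card_erase_of_mem (Finset.mem_univ i), Finset.card_univ, Fintype.card_fin] at this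
  by_cases h0 : ∃ l0, y j l0 ≠ 0
  · obtain ⟨l0, h0⟩ := h0
    refine (hcl (insert (y i l0) (⋃ i' ∈ Finset.univ.erase i, Set.range (y i'))) ?_).trans ?_
    · intro i' l
      by_cases hi : i' = i
      · subst hi
        have h1 : IsAlgebraic (Algebra.adjoin k (insert (y i' l0) (⋃ i'' ∈ Finset.univ.erase i', Set.range (y i''))))
          (y i' l * y j l0) := by
          rw [hmin]
          apply IsAlgebraic.mul
          · exact hmem _ _ (Set.mem_insert _ _)
          · refine hmem _ _ (Set.mem_insert_of_mem _ ?_)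
            simp only [Set.mem_iUnion]
            exact ⟨j, by simp [hij.symm], l, rfl⟩
        have h2 : IsAlgebraic (Algebra.adjoin k (insert (y i' l0) (⋃ i'' ∈ Finset.univ.erase i', Set.range (y i''))))
          (y j l0) := by
          refine hmem _ _ (Set.mem_insert_of_mem _ ?_)
          simp only [Set.mem_iUnion]
          exact ⟨j, by simp [hij.symm], l0, rfl⟩
        rw [mul_comm] at h1
        exact IsAlgebraic.of_mul (mem_nonZeroDivisors_of_ne_zero h0) h2 h1
      · refine hmem _ _ (Set.mem_insert_of_mem _ ?_)
        simp only [Set.mem_iUnion]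
        exact ⟨i', by simp [hi], l, rfl⟩
    · rw [Set.insert_eq]
      have := Matroid.cRk_inter_add_cRk_union_le (M := M) (X := {y i l0})
        (Y := ⋃ i' ∈ Finset.univ.erase i, Set.range (y i'))
      refine (le_trans le_add_self this).trans ?_
      push_cast
      have h1 : M.cRk {y i l0} ≤ 1 := (Matroid.cRk_le_cardinalMk _ _).trans (by simp)
      have h2 := hb i
      push_cast at h2
      exact add_le_add h1 h2
  · push Not at h0
    refine ((hcl (⋃ i' ∈ Finset.univ.erase j, Set.range (y i')) ?_).trans (hb j)).trans ?_
    · intro i' l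
      by_cases hi : i' = j
      · subst hi
        rw [h0]; exact isAlgebraic_zero
      · refine hmem _ _ ?_
        simp only [Set.mem_iUnion]
        exact ⟨i', by simp [hi], l, rfl⟩
    · norm_cast; omega

lemma fsq {k R : Type} [Field k] [CommRing R] [Algebra k R] (p : Ideal R) [p.IsPrime] :
    FaithfulSMul k (R ⧸ p) :=
  (faithfulSMul_iff_algebraMap_injective k (R ⧸ p)).2 (algebraMap k (R ⧸ p)).injective

/-- The affine product cone. -/
def prodSet {k : Type} (a : ℕ) {m : ℕ} (Y : Set (Fin m → k)) : Set (Fin a × Fin m → k) :=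
  {w | ∀ i, (fun l => w (i, l)) ∈ Y}

/-- Replace one block. -/
def upd {k : Type} {a m : ℕ} (w : Fin a × Fin m → k) (i : Fin a) (u : Fin m → k) :
    Fin a × Fin m → k := fun p => if p.1 = i then u p.2 else w p

lemma upd_self {k : Type} {a m : ℕ} (w : Fin a × Fin m → k) (i : Fin a) :
    upd w i (fun l => w (i, l)) = w := by
  funext p
  rcases p with ⟨j, l⟩
  by_cases h : j = i
  · subst h; simp [upd]
  · simp [upd, h]

lemma exists_block {k : Type} [Field k] {a m : ℕ} (f : MvPolynomial (Fin a × Fin m) k)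
    (w : Fin a × Fin m → k) (i : Fin a) :
    ∃ g : MvPolynomial (Fin m) k, ∀ u, aeval u g = aeval (upd w i u) f := by
  refine ⟨aeval (fun p => if p.1 = i then X p.2 else C (w p)) f, fun u => ?_⟩
  rw [← AlgHom.comp_apply, comp_aeval]
  congr 2
  funext p
  by_cases h : p.1 = i <;> simp [h, upd]

lemma upd_mem {k : Type} {a m : ℕ} {Y : Set (Fin m → k)} {w : Fin a × Fin m → k}
    (hw : w ∈ prodSet a Y) (i : Fin a) {u : Fin m → k} (hu : u ∈ Y) : upd w i u ∈ prodSet a Y := by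
  intro j
  by_cases h : j = i
  · simpa [upd, h] using hu
  · simpa [upd, h] using hw j

lemma prodSet_irred {k : Type} [Field k] {a m : ℕ} {Y : Set (Fin m → k)}
    (hY : (vanishingIdeal k Y).IsPrime) (f g : MvPolynomial (Fin a × Fin m) k)
    (y z : Fin a × Fin m → k) (hy : y ∈ prodSet a Y) (hz : z ∈ prodSet a Y)
    (hf : aeval y f ≠ 0) (hg : aeval z g ≠ 0) :
    ∃ w ∈ prodSet a Y, aeval w f ≠ 0 ∧ aeval w g ≠ 0 := by
  classical
  have key : ∀ T : Finset (Fin a), ∃ y ∈ prodSet a Y, ∃ z ∈ prodSet a Y,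
      aeval y f ≠ 0 ∧ aeval z g ≠ 0 ∧ ∀ i ∈ T, ∀ l, y (i, l) = z (i, l) := by
    intro T
    induction T using Finset.induction_on with
    | empty => exact ⟨y, hy, z, hz, hf, hg, by simp⟩
    | insert i T hi ih =>
      obtain ⟨y, hy, z, hz, hf, hg, h⟩ := ih
      obtain ⟨f', hf'⟩ := exists_block f y i
      obtain ⟨g', hg'⟩ := exists_block g z i
      have h1 : f' * g' ∉ vanishingIdeal k Y := by
        intro hmem
        rcases hY.mem_or_mem hmem with h2 | h2
        · have := h2 _ (hy i)
          rw [hf', upd_self] at this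
          exact hf this
        · have := h2 _ (hz i)
          rw [hg', upd_self] at this
          exact hg this
      rw [mem_vanishingIdeal_iff] at h1
      push Not at h1
      obtain ⟨u, hu, hne⟩ := h1
      rw [map_mul, hf', hg'] at hne
      refine ⟨upd y i u, upd_mem hy i hu, upd z i u, upd_mem hz i hu, left_ne_zero_of_mul hne,
        right_ne_zero_of_mul hne, ?_⟩
      intro j hj l
      by_cases hji : j = i
      · simp [upd, hji]
      · simp only [upd, hji, if_false]
        exact h j (Finset.mem_of_mem_insert_of_ne hj hji) l
  obtain ⟨y, hy, z, hz, hf, hg, h⟩ := key Finset.univ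
  have : y = z := by
    funext p; exact h p.1 (Finset.mem_univ _) p.2
  subst this
  exact ⟨y, hy, hf, hg⟩

lemma prodSet_prime {k : Type} [Field k] {a m : ℕ} {Y : Set (Fin m → k)} (hne : Y.Nonempty)
    (hY : (vanishingIdeal k Y).IsPrime) : (vanishingIdeal k (prodSet a Y)).IsPrime := by
  refine ⟨?_, ?_⟩
  · rw [Ideal.ne_top_iff_one]
    intro h
    obtain ⟨u, hu⟩ := hne
    have := h (fun p => u p.2) (fun i => hu)
    simp at this
  · intro f g hfg
    by_contra hcon
    push Not at hcon
    obtain ⟨h1, h2⟩ := hcon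
    rw [mem_vanishingIdeal_iff] at h1 h2
    push Not at h1 h2
    obtain ⟨y, hy, hf⟩ := h1
    obtain ⟨z, hz, hg⟩ := h2
    obtain ⟨w, hw, h3, h4⟩ := prodSet_irred hY f g y z hy hz hf hg
    have := hfg w hw
    rw [map_mul] at this
    exact (mul_ne_zero h3 h4) this

lemma rename_mem {k : Type} [Field k] {a m : ℕ} {Y : Set (Fin m → k)} (i : Fin a)
    {f : MvPolynomial (Fin m) k} (hf : f ∈ vanishingIdeal k Y) :
    rename (fun l => (i, l)) f ∈ vanishingIdeal k (prodSet a Y) := by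
  intro w hw
  rw [aeval_rename]
  exact hf _ (hw i)

lemma dense_vanish {k : Type} [Field k] [Infinite k] {a N : ℕ} (D : Set (Fin N → k))
    (hD : ∀ P : MvPolynomial (Fin N) k, (∀ u ∈ D, aeval u P = 0) → P = 0)
    (P : MvPolynomial (Fin a × Fin N) k) (hP : ∀ w ∈ prodSet a D, aeval w P = 0) : P = 0 := by
  classical
  have key : ∀ T : Finset (Fin a), ∀ w : Fin a × Fin N → k, (∀ i ∉ T, (fun l => w (i,l)) ∈ D) →
      aeval w P = 0 := by
    intro T
    induction T using Finset.induction_on with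
    | empty => intro w hw; exact hP w (fun i => hw i (by simp))
    | insert i T hi ih =>
      intro w hw
      obtain ⟨P', hP'⟩ := exists_block P w i
      have h0 : P' = 0 := by
        apply hD
        intro u hu
        rw [hP']
        apply ih
        intro j hj
        by_cases hji : j = i
        · simpa [upd, hji] using hu
        · simpa [upd, hji] using hw j (by simp [hji, hj])
      have := hP' (fun l => w (i, l))
      rw [upd_self, h0] at this
      simpa using this.symm
  apply MvPolynomial.funext
  intro w
  have := key Finset.univ w (by simp)
  simpa [aeval_eq_eval] using this

lemma trdeg_prod_ge {k : Type} [Field k] [Infinite k] {a m N : ℕ} {Y : Set (Fin m → k)}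
    (hN : (N : Cardinal) ≤ Algebra.trdeg k (MvPolynomial (Fin m) k ⧸ vanishingIdeal k Y))
    (hY : (vanishingIdeal k Y).IsPrime) :
    ((a * N : ℕ) : Cardinal) ≤
      Algebra.trdeg k (MvPolynomial (Fin a × Fin m) k ⧸ vanishingIdeal k (prodSet a Y)) := by
  have : FaithfulSMul k (MvPolynomial (Fin m) k ⧸ vanishingIdeal k Y) :=
    fsq _
  obtain ⟨s, hs⟩ := exists_isTranscendenceBasis k (MvPolynomial (Fin m) k ⧸ vanishingIdeal k Y)
  rw [← hs.cardinalMk_eq_trdeg] at hN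
  have hN' : Cardinal.mk (Fin N) ≤ Cardinal.mk s := by simpa using hN
  obtain ⟨e⟩ := Cardinal.le_def _ _ |>.1 hN'
  have hsurj : Function.Surjective (Ideal.Quotient.mkₐ k (vanishingIdeal k Y)) :=
    Ideal.Quotient.mkₐ_surjective k _
  choose F hF using fun j : Fin N => hsurj (e j).1
  have hind : AlgebraicIndependent k ((Ideal.Quotient.mkₐ k (vanishingIdeal k Y)) ∘ F) := by
    have : (Ideal.Quotient.mkₐ k (vanishingIdeal k Y)) ∘ F = Subtype.val ∘ e := funext hF
    rw [this]
    exact hs.1.comp _ e.injective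
  let D : Set (Fin N → k) := (fun y j => aeval y (F j)) '' Y
  have hD : ∀ P : MvPolynomial (Fin N) k, (∀ u ∈ D, aeval u P = 0) → P = 0 := by
    intro P hP
    rw [algebraicIndependent_iff] at hind
    apply hind
    have h1 : aeval ((Ideal.Quotient.mkₐ k (vanishingIdeal k Y)) ∘ F) P =
        Ideal.Quotient.mkₐ k (vanishingIdeal k Y) (aeval F P) :=
      (AlgHom.congr_fun (MvPolynomial.comp_aeval (f := F)
        (φ := Ideal.Quotient.mkₐ k (vanishingIdeal k Y))) P).symm
    rw [h1]
    refine Ideal.Quotient.eq_zero_iff_mem.2 ?_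
    intro y hy
    rw [← AlgHom.comp_apply, comp_aeval]
    exact hP _ ⟨y, hy, rfl⟩
  have key : AlgebraicIndependent k (fun p : Fin a × Fin N =>
      Ideal.Quotient.mkₐ k (vanishingIdeal k (prodSet a Y)) (rename (fun l => (p.1, l)) (F p.2))) := by
    rw [algebraicIndependent_iff]
    intro P hP
    rw [← MvPolynomial.comp_aeval (f := fun p : Fin a × Fin N => rename (fun l => (p.1, l)) (F p.2))
      (φ := Ideal.Quotient.mkₐ k (vanishingIdeal k (prodSet a Y))), AlgHom.comp_apply] at hP
    have hP' := Ideal.Quotient.eq_zero_iff_mem.1 hP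
    apply dense_vanish D hD
    intro w hw
    choose y hyY hy using hw
    have h2 := hP' (fun p => y p.1 p.2) (fun i => hyY i)
    rw [← AlgHom.comp_apply, comp_aeval] at h2
    rw [← h2]
    congr 2
    funext p
    rw [aeval_rename]
    exact (congr_fun (hy p.1) p.2).symm
  have := key.cardinalMk_le_trdeg
  simpa using this

/-- Pairwise non-proportional blocks. -/
def NonPar {E : Type} [Mul E] {a m : ℕ} (y : Fin a × Fin m → E) : Prop :=
  ∀ i j, i ≠ j → ∃ l l', y (i, l) * y (j, l') ≠ y (i, l') * y (j, l)

/-- Uniqueness of decompositions. -/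
def UniqDec {k : Type} [Field k] (a : ℕ) {m : ℕ} (Y : Set (Fin m → k)) : Prop :=
  ∀ y ∈ prodSet a Y, ∀ y' ∈ prodSet a Y, NonPar y → NonPar y' →
    (∀ l, ∑ i, y (i, l) = ∑ i, y' (i, l)) → ∃ σ : Equiv.Perm (Fin a), ∀ i l, y' (i, l) = y (σ i, l)

lemma transfer {k : Type} [Field k] [IsAlgClosed k] {a m : ℕ} {Y : Set (Fin m → k)}
    (hcl : ∀ v, (∀ f ∈ vanishingIdeal k Y, aeval v f = 0) → v ∈ Y)
    (hU : UniqDec a Y) {Ω : Type} [Field Ω] [Algebra k Ω] (z z' : Fin a × Fin m → Ω)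
    (hz : ∀ f ∈ vanishingIdeal k (prodSet a Y), aeval z f = 0)
    (hz' : ∀ f ∈ vanishingIdeal k (prodSet a Y), aeval z' f = 0)
    (hp : NonPar z) (hp' : NonPar z') (hsum : ∀ l, ∑ i, z (i, l) = ∑ i, z' (i, l)) :
    ∃ σ : Equiv.Perm (Fin a), ∀ i l, z' (i, l) = z (σ i, l) := by
  classical
  by_contra hcon
  push Not at hcon
  choose I L hIL using hcon
  have : Nonempty (Fin m) := ⟨L 1⟩
  choose! l₁ l₂ hl using hp
  choose! l₁' l₂' hl' using hp'
  let Z : (Fin a × Fin m) ⊕ (Fin a × Fin m) → Ω := Sum.elim z z'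
  let φ : MvPolynomial ((Fin a × Fin m) ⊕ (Fin a × Fin m)) k →ₐ[k] Ω := aeval Z
  let P := RingHom.ker φ
  have hP : P.IsPrime := RingHom.ker_isPrime _
  let E : MvPolynomial ((Fin a × Fin m) ⊕ (Fin a × Fin m)) k :=
    (∏ σ : Equiv.Perm (Fin a), (X (Sum.inr (I σ, L σ)) - X (Sum.inl (σ (I σ), L σ)))) *
    ((∏ p : {p : Fin a × Fin a // p.1 ≠ p.2},
      (X (Sum.inl (p.1.1, l₁ p.1.1 p.1.2)) * X (Sum.inl (p.1.2, l₂ p.1.1 p.1.2))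
      - X (Sum.inl (p.1.1, l₂ p.1.1 p.1.2)) * X (Sum.inl (p.1.2, l₁ p.1.1 p.1.2)))) *
    (∏ p : {p : Fin a × Fin a // p.1 ≠ p.2},
      (X (Sum.inr (p.1.1, l₁' p.1.1 p.1.2)) * X (Sum.inr (p.1.2, l₂' p.1.1 p.1.2))
      - X (Sum.inr (p.1.1, l₂' p.1.1 p.1.2)) * X (Sum.inr (p.1.2, l₁' p.1.1 p.1.2)))))
  have hE : E ∉ P := by
    intro h
    have h : φ E = 0 := h
    simp only [E, φ, map_mul, map_prod, map_sub, aeval_X, Z, Sum.elim_inl, Sum.elim_inr] at h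
    refine mul_ne_zero ?_ (mul_ne_zero ?_ ?_) h
    · exact Finset.prod_ne_zero_iff.2 fun σ _ => sub_ne_zero.2 (hIL σ)
    · exact Finset.prod_ne_zero_iff.2 fun p _ => sub_ne_zero.2 (hl _ _ p.2)
    · exact Finset.prod_ne_zero_iff.2 fun p _ => sub_ne_zero.2 (hl' _ _ p.2)
  rw [← MvPolynomial.IsPrime.vanishingIdeal_zeroLocus (K := k) P] at hE
  rw [mem_vanishingIdeal_iff] at hE
  push Not at hE
  obtain ⟨w, hw, hEw⟩ := hE
  have hw' : ∀ f, φ f = 0 → aeval w f = 0 := fun f hf => hw f hf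
  simp only [E, map_mul, map_prod, map_sub, aeval_X] at hEw
  have h1 := left_ne_zero_of_mul hEw
  have h2 := left_ne_zero_of_mul (right_ne_zero_of_mul hEw)
  have h3 := right_ne_zero_of_mul (right_ne_zero_of_mul hEw)
  rw [Finset.prod_ne_zero_iff] at h1 h2 h3
  obtain ⟨σ, hσ⟩ := hU (fun p => w (Sum.inl p)) (by
      intro i
      apply hcl
      intro f hf
      have := hw' (rename Sum.inl (rename (fun l => (i, l)) f)) (by
        rw [aeval_rename]
        exact hz _ (rename_mem i hf))
      rw [aeval_rename, aeval_rename] at this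
      exact this) (fun p => w (Sum.inr p)) (by
      intro i
      apply hcl
      intro f hf
      have := hw' (rename Sum.inr (rename (fun l => (i, l)) f)) (by
        rw [aeval_rename]
        exact hz' _ (rename_mem i hf))
      rw [aeval_rename, aeval_rename] at this
      exact this)
      (fun i j hij => ⟨_, _, sub_ne_zero.1 (h2 ⟨(i, j), hij⟩ (Finset.mem_univ _))⟩)
      (fun i j hij => ⟨_, _, sub_ne_zero.1 (h3 ⟨(i, j), hij⟩ (Finset.mem_univ _))⟩) (by
      intro l
      have := hw' ((∑ i, X (Sum.inl (i, l))) - ∑ i, X (Sum.inr (i, l))) (by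
        simp only [φ, Z, map_sub, map_sum, aeval_X, Sum.elim_inl, Sum.elim_inr]
        rw [hsum, sub_self])
      simpa only [map_sub, map_sum, aeval_X, sub_eq_zero] using this)
  exact sub_ne_zero.1 (h1 σ (Finset.mem_univ _)) (hσ _ _)

lemma lift_ringHom {R S M : Type} [CommRing R] [IsDomain R] [CommRing S] [IsDomain S] [Algebra R S]
    [FaithfulSMul R S]
    [Algebra.IsAlgebraic R S] [Field M] [IsAlgClosed M] (g : R →+* M) (hg : Function.Injective g) :
    ∃ h : S →+* M, ∀ x, h (algebraMap R S x) = g x := by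
  letI : Algebra R M := g.toAlgebra
  have : FaithfulSMul R M := (faithfulSMul_iff_algebraMap_injective R M).2 hg
  have : Module.IsTorsionFree R M := inferInstance
  have : Module.IsTorsionFree R S := inferInstance
  let h : S →ₐ[R] M := IsAlgClosed.lift
  exact ⟨h.toRingHom, fun x => h.commutes x⟩

lemma shift {A Ω : Type} [CommRing A] [IsDomain A] [Field Ω] [IsAlgClosed Ω] [Algebra A Ω]
    [FaithfulSMul A Ω] (t : Ω) (ht : Transcendental A t) (c : A) :
    ∃ ψ : Ω →ₐ[A] Ω, ψ t = t + algebraMap A Ω c := by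
  classical
  have h1 : AlgebraicIndepOn A id ({t} : Set Ω) := by
    have : AlgebraicIndependent A (fun x : ({t} : Set Ω) => id x.1) := by
      rw [algebraicIndependent_unique_type_iff]
      exact ht
    exact this
  obtain ⟨T, hT, hb⟩ := exists_isTranscendenceBasis_superset h1
  have htT : t ∈ T := hT rfl
  let sh : A → MvPolynomial T A →ₐ[A] MvPolynomial T A := fun c =>
    aeval (fun x => X x + if x.1 = t then C c else 0)
  have hsh : (sh (-c)).comp (sh c) = AlgHom.id A _ := by
    ext x
    simp only [sh, AlgHom.comp_apply, aeval_X, map_add, AlgHom.id_apply]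
    by_cases h : x.1 = t <;> simp [h]
  have hshi : Function.Injective (sh c) := by
    apply Function.LeftInverse.injective (g := sh (-c))
    intro P
    exact AlgHom.congr_fun hsh P
  let e := hb.1.aevalEquiv
  let g : Algebra.adjoin A (Set.range (Subtype.val : T → Ω)) →ₐ[A] Ω :=
    ((aeval (Subtype.val : T → Ω)).comp (sh c)).comp e.symm.toAlgHom
  have hg : Function.Injective g := by
    have h2 : Function.Injective (aeval (Subtype.val : T → Ω) : MvPolynomial T A →ₐ[A] Ω) := hb.1
    exact (h2.comp hshi).comp e.symm.injective
  have := hb.isAlgebraic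
  obtain ⟨h, hh⟩ := lift_ringHom (S := Ω) g.toRingHom hg
  refine ⟨{ h with commutes' := ?_ }, ?_⟩
  · intro x
    have := hh (algebraMap A _ x)
    exact this.trans (g.commutes x)
  · have h3 := hh (e (X ⟨t, htT⟩))
    have h4 : algebraMap (Algebra.adjoin A (Set.range (Subtype.val : T → Ω))) Ω (e (X ⟨t, htT⟩)) = t := by
      simp [e]
    rw [h4] at h3
    refine h3.trans ?_
    simp [g, sh]

lemma alg_of_nonPar {k : Type} [Field k] [IsAlgClosed k] {a m : ℕ} {Y : Set (Fin m → k)}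
    (hcl : ∀ v, (∀ f ∈ vanishingIdeal k Y, aeval v f = 0) → v ∈ Y)
    (hU : UniqDec a Y) {A Ω : Type} [CommRing A] [IsDomain A] [Algebra k A]
    [Field Ω] [IsAlgClosed Ω] [Algebra A Ω] [Algebra k Ω] [IsScalarTower k A Ω]
    [FaithfulSMul A Ω] (z : Fin a × Fin m → Ω)
    (hz : ∀ f ∈ vanishingIdeal k (prodSet a Y), aeval z f = 0)
    (hp : NonPar z) (hsum : ∀ l, ∑ i, z (i, l) ∈ Set.range (algebraMap A Ω)) :
    (∀ ψ : Ω →ₐ[A] Ω, ∃ σ : Equiv.Perm (Fin a), ∀ i l, ψ (z (i, l)) = z (σ i, l)) ∧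
    ∀ p, IsAlgebraic A (z p) := by
  have key : ∀ ψ : Ω →ₐ[A] Ω, ∃ σ : Equiv.Perm (Fin a), ∀ i l, ψ (z (i, l)) = z (σ i, l) := by
    intro ψ
    apply transfer hcl hU z (fun p => ψ (z p)) hz _ hp
    · intro i j hij
      obtain ⟨l, l', h⟩ := hp i j hij
      refine ⟨l, l', fun h' => h ?_⟩
      rw [← map_mul, ← map_mul] at h'
      exact ψ.injective h'
    · intro l
      rw [← map_sum]
      obtain ⟨x, hx⟩ := hsum l
      rw [← hx, ψ.commutes]
    · intro f hf
      have := AlgHom.congr_fun (MvPolynomial.comp_aeval (f := z) (φ := ψ.restrictScalars k)) f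
      rw [AlgHom.comp_apply, hz f hf, map_zero] at this
      exact this.symm
  refine ⟨key, ?_⟩
  intro p
  by_contra htr
  have hall : ∀ c : k, ∃ q, z p + algebraMap k Ω c = z q := by
    intro c
    obtain ⟨ψ, hψ⟩ := shift (z p) htr (algebraMap k A c)
    obtain ⟨σ, hσ⟩ := key ψ
    refine ⟨(σ p.1, p.2), ?_⟩
    rw [← hσ, hψ, ← IsScalarTower.algebraMap_apply]
  choose q hq using hall
  have hqi : Function.Injective q := by
    intro c c' h
    have : z p + algebraMap k Ω c = z p + algebraMap k Ω c' := by rw [hq, hq, h]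
    exact (algebraMap k Ω).injective (add_left_cancel this)
  have := Finite.of_injective q hqi
  have hinf : Infinite k := IsAlgClosed.instInfinite
  exact hinf.not_finite this

lemma alg_and_rational {k : Type} [Field k] [IsAlgClosed k] {a m : ℕ} {Y : Set (Fin m → k)}
    (hcl : ∀ v, (∀ f ∈ vanishingIdeal k Y, aeval v f = 0) → v ∈ Y)
    (hU : UniqDec a Y) {A D : Type} [CommRing A] [IsDomain A] [Algebra k A]
    [CommRing D] [IsDomain D] [Algebra A D] [Algebra k D] [IsScalarTower k A D]
    [FaithfulSMul A D] (y : Fin a × Fin m → D)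
    (hgen : Algebra.adjoin k (Set.range y) = ⊤)
    (hz : ∀ f ∈ vanishingIdeal k (prodSet a Y), aeval y f = 0)
    (hp : NonPar y) (hsum : ∀ l, ∑ i, y (i, l) ∈ Set.range (algebraMap A D)) :
    Algebra.IsAlgebraic A D ∧ (CharZero A → ∀ l, ∃ f g : A, g ≠ 0 ∧
      algebraMap A D g * (∑ i, y (i, l) ^ 2) = algebraMap A D f) := by
  let Ω := AlgebraicClosure (FractionRing D)
  have hinjD : Function.Injective (algebraMap D Ω) := by
    rw [IsScalarTower.algebraMap_eq D (FractionRing D) Ω]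
    exact (algebraMap (FractionRing D) Ω).injective.comp (IsFractionRing.injective D (FractionRing D))
  have hinjA : Function.Injective (algebraMap A Ω) := by
    rw [IsScalarTower.algebraMap_eq A D Ω]
    exact hinjD.comp (FaithfulSMul.algebraMap_injective A D)
  have : FaithfulSMul A Ω := (faithfulSMul_iff_algebraMap_injective A Ω).2 hinjA
  obtain ⟨hfix, halg⟩ := alg_of_nonPar (A := A) (Ω := Ω) hcl hU (fun p => algebraMap D Ω (y p)) (by
      intro f hf
      have := AlgHom.congr_fun (MvPolynomial.comp_aeval (f := y) (φ := IsScalarTower.toAlgHom k D Ω)) f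
      rw [AlgHom.comp_apply, hz f hf, map_zero] at this
      exact this.symm) (by
      intro i j hij
      obtain ⟨l, l', h⟩ := hp i j hij
      refine ⟨l, l', fun h' => h (hinjD ?_)⟩
      rw [map_mul, map_mul]
      exact h') (by
      intro l
      obtain ⟨x, hx⟩ := hsum l
      refine ⟨x, ?_⟩
      rw [← map_sum, ← hx, ← IsScalarTower.algebraMap_apply])
  have hA : Algebra.IsAlgebraic A D := by
    have h1 : Algebra.adjoin k (Set.range y) ≤
      (Subalgebra.algebraicClosure A D).restrictScalars k := by
      rw [Algebra.adjoin_le_iff]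
      rintro _ ⟨p, rfl⟩
      exact (isAlgebraic_algebraMap_iff hinjD).1 (halg p)
    rw [hgen] at h1
    exact ⟨fun x => h1 (Algebra.mem_top)⟩
  refine ⟨hA, fun hchar l => ?_⟩
  have hDF : Algebra.IsAlgebraic D (FractionRing D) :=
    IsLocalization.isAlgebraic (FractionRing D) (nonZeroDivisors D)
  have hDΩ : Algebra.IsAlgebraic D Ω := Algebra.IsAlgebraic.trans D (FractionRing D) Ω
  have hAΩ : Algebra.IsAlgebraic A Ω := Algebra.IsAlgebraic.trans A D Ω
  letI : Algebra (FractionRing A) Ω := FractionRing.liftAlgebra A Ω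
  have : IsScalarTower A (FractionRing A) Ω := FractionRing.isScalarTower_liftAlgebra A Ω
  have hKΩ : Algebra.IsAlgebraic (FractionRing A) Ω := 
    Algebra.IsAlgebraic.extendScalars (IsFractionRing.injective A (FractionRing A))
  have : CharZero (FractionRing A) :=
    charZero_of_injective_algebraMap (IsFractionRing.injective A (FractionRing A))
  have : IsAlgClosure (FractionRing A) Ω := ⟨inferInstance, hKΩ⟩
  have : Normal (FractionRing A) Ω := IsAlgClosure.normal _ _
  have : IsGalois (FractionRing A) Ω := ⟨⟩
  have hmem : algebraMap D Ω (∑ i, y (i, l) ^ 2) ∈ (⊥ : IntermediateField (FractionRing A) Ω) := by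
    rw [InfiniteGalois.mem_bot_iff_fixed]
    intro f
    obtain ⟨σ, hσ⟩ := hfix (f.toAlgHom.restrictScalars A)
    rw [map_sum, map_sum]
    have h1 : ∀ i, f (algebraMap D Ω (y (i, l) ^ 2)) = algebraMap D Ω (y (σ i, l) ^ 2) := by
      intro i
      have := hσ i l
      rw [map_pow, map_pow, map_pow]
      congr 1
    simp_rw [h1]
    exact Equiv.sum_comp σ (fun i => algebraMap D Ω (y (i, l) ^ 2))
  obtain ⟨q, hq⟩ := IntermediateField.mem_bot.1 hmem
  obtain ⟨f, g, hg, rfl⟩ := IsFractionRing.div_surjective (A := A) q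
  have hg0 : g ≠ 0 := nonZeroDivisors.ne_zero hg
  refine ⟨f, g, hg0, hinjD ?_⟩
  rw [map_mul, ← IsScalarTower.algebraMap_apply, ← IsScalarTower.algebraMap_apply, ← hq, map_div₀,
    ← IsScalarTower.algebraMap_apply, ← IsScalarTower.algebraMap_apply]
  rw [mul_div_cancel₀]
  intro h
  exact hg0 (hinjA (by rw [h, map_zero]))

lemma trdeg_le_of_par {k : Type} [Field k] {a m N : ℕ} {Y : Set (Fin m → k)}
    (hN : Algebra.trdeg k (MvPolynomial (Fin m) k ⧸ vanishingIdeal k Y) ≤ N)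
    (q : Ideal (MvPolynomial (Fin a × Fin m) k)) [q.IsPrime]
    (hq : vanishingIdeal k (prodSet a Y) ≤ q)
    (hp : ¬ NonPar (fun p => Ideal.Quotient.mkₐ k q (X p))) :
    Algebra.trdeg k (MvPolynomial (Fin a × Fin m) k ⧸ q) ≤ (1 + (a - 1) * N : ℕ) := by
  have : FaithfulSMul k (MvPolynomial (Fin a × Fin m) k ⧸ q) := fsq q
  simp only [NonPar] at hp
  push Not at hp
  obtain ⟨i, j, hij, hmin⟩ := hp
  refine trdeg_pair (fun i l => Ideal.Quotient.mkₐ k q (X (i, l))) N ?_ ?_ i j hij hmin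
  · have h1 : (⋃ i, Set.range fun l => Ideal.Quotient.mkₐ k q (X (i, l)))
        = (Ideal.Quotient.mkₐ k q) '' (Set.range X) := by
      ext x
      simp
    rw [h1, ← AlgHom.map_adjoin, adjoin_range_X, Algebra.map_top]
    exact (AlgHom.range_eq_top _).2 (Ideal.Quotient.mkₐ_surjective k q)
  · intro i
    have hle : vanishingIdeal k Y ≤ q.comap (rename (fun l => (i, l)) :
      MvPolynomial (Fin m) k →ₐ[k] MvPolynomial (Fin a × Fin m) k) := by
      intro f hf
      exact hq (rename_mem i hf)
    refine (cRk_le_trdeg (Ideal.quotientMapₐ q (rename (fun l => (i, l)) :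
      MvPolynomial (Fin m) k →ₐ[k] MvPolynomial (Fin a × Fin m) k)
      (I := vanishingIdeal k Y) hle) _ ?_).trans hN
    rintro _ ⟨l, rfl⟩
    refine ⟨Ideal.Quotient.mk _ (X l), ?_⟩
    rw [Ideal.quotient_map_mkₐ, rename_X]

lemma trdeg_quot_lt_quot {k R : Type} [Field k] [CommRing R] [Algebra k R]
    (p p' : Ideal R) [p.IsPrime] [p'.IsPrime] (h : p < p') :
    Algebra.trdeg k (R ⧸ p') + 1 ≤ Algebra.trdeg k (R ⧸ p) := by
  have hsurj : Function.Surjective (Ideal.Quotient.mkₐ k p) := Ideal.Quotient.mkₐ_surjective k p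
  have hker : RingHom.ker (Ideal.Quotient.mkₐ k p) = p := by
    ext x
    rw [RingHom.mem_ker]
    exact Ideal.Quotient.eq_zero_iff_mem
  have hpr : (p'.map (Ideal.Quotient.mkₐ k p)).IsPrime := by
    apply Ideal.map_isPrime_of_surjective hsurj
    rw [hker]
    exact h.le
  have hne : p'.map (Ideal.Quotient.mkₐ k p) ≠ ⊥ := by
    intro hb
    rw [Ideal.map_eq_bot_iff_le_ker, hker] at hb
    exact h.not_ge hb
  refine le_trans ?_ (trdeg_quot_lt (p'.map (Ideal.Quotient.mkₐ k p)) hne)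
  gcongr
  let e := DoubleQuot.quotQuotEquivQuotOfLEₐ k h.le
  exact trdeg_le_of_injective e.symm.toAlgHom e.symm.injective

/-- The sum map on coordinate rings. -/
def sumHom (k : Type) [Field k] (a m : ℕ) :
    MvPolynomial (Fin m) k →ₐ[k] MvPolynomial (Fin a × Fin m) k :=
  aeval (fun l => ∑ i, X (i, l))

lemma aeval_sumHom {k : Type} [Field k] {a m : ℕ} (f : MvPolynomial (Fin m) k)
    (y : Fin a × Fin m → k) : aeval y (sumHom k a m f) = aeval (fun l => ∑ i, y (i, l)) f := by
  rw [sumHom, ← AlgHom.comp_apply, comp_aeval]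
  congr 2
  funext l
  simp

lemma quot_alg {k : Type} [Field k] [IsAlgClosed k] [CharZero k] {a m : ℕ} {Y : Set (Fin m → k)}
    (hcl : ∀ v, (∀ f ∈ vanishingIdeal k Y, aeval v f = 0) → v ∈ Y)
    (hU : UniqDec a Y)
    (q : Ideal (MvPolynomial (Fin a × Fin m) k)) [q.IsPrime]
    (hq : vanishingIdeal k (prodSet a Y) ≤ q)
    (hp : NonPar (fun p => Ideal.Quotient.mkₐ k q (X p))) :
    Algebra.trdeg k (MvPolynomial (Fin a × Fin m) k ⧸ q) ≤
      Algebra.trdeg k (MvPolynomial (Fin m) k ⧸ q.comap (sumHom k a m)) ∧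
    ∀ l, ∃ f g : MvPolynomial (Fin m) k, g ∉ q.comap (sumHom k a m) ∧
      sumHom k a m g * (∑ i, X (i, l) ^ 2) - sumHom k a m f ∈ q := by
  set p := q.comap (sumHom k a m) with hpdef
  have hpp : p.IsPrime := inferInstance
  let φ := Ideal.quotientMapₐ q (sumHom k a m) (I := p) le_rfl
  letI : Algebra (MvPolynomial (Fin m) k ⧸ p) (MvPolynomial (Fin a × Fin m) k ⧸ q) :=
    φ.toRingHom.toAlgebra
  have hφ : Function.Injective φ := Ideal.quotientMap_injective' (H := le_rfl) le_rfl
  have : IsScalarTower k (MvPolynomial (Fin m) k ⧸ p) (MvPolynomial (Fin a × Fin m) k ⧸ q) :=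
    IsScalarTower.of_algebraMap_eq fun x => (φ.commutes x).symm
  have : FaithfulSMul (MvPolynomial (Fin m) k ⧸ p) (MvPolynomial (Fin a × Fin m) k ⧸ q) :=
    (faithfulSMul_iff_algebraMap_injective _ _).2 hφ
  have hφmk : ∀ f, algebraMap (MvPolynomial (Fin m) k ⧸ p) (MvPolynomial (Fin a × Fin m) k ⧸ q)
      (Ideal.Quotient.mk p f) = Ideal.Quotient.mk q (sumHom k a m f) := fun f => rfl
  have hchar : CharZero (MvPolynomial (Fin m) k ⧸ p) :=
    charZero_of_injective_algebraMap (algebraMap k (MvPolynomial (Fin m) k ⧸ p)).injective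
  obtain ⟨h1, h2⟩ := alg_and_rational (A := MvPolynomial (Fin m) k ⧸ p)
    (D := MvPolynomial (Fin a × Fin m) k ⧸ q) hcl hU
    (fun p => Ideal.Quotient.mkₐ k q (X p)) (by
      have h1 : (Set.range fun p => Ideal.Quotient.mkₐ k q (X p))
          = (Ideal.Quotient.mkₐ k q) '' (Set.range X) := by
        ext x
        simp
      rw [h1, ← AlgHom.map_adjoin, adjoin_range_X, Algebra.map_top]
      exact (AlgHom.range_eq_top _).2 (Ideal.Quotient.mkₐ_surjective k q)) (by
      intro f hf
      have := AlgHom.congr_fun (MvPolynomial.comp_aeval (f := X) (φ := Ideal.Quotient.mkₐ k q)) f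
      rw [AlgHom.comp_apply, aeval_X_left_apply] at this
      rw [← this]
      exact Ideal.Quotient.eq_zero_iff_mem.2 (hq hf)) hp (by
      intro l
      refine ⟨Ideal.Quotient.mk p (X l), ?_⟩
      rw [hφmk]
      simp [sumHom])
  refine ⟨trdeg_le_of_alg, fun l => ?_⟩
  obtain ⟨f, g, hg, hfg⟩ := h2 hchar l
  obtain ⟨f, rfl⟩ := Ideal.Quotient.mk_surjective f
  obtain ⟨g, rfl⟩ := Ideal.Quotient.mk_surjective g
  refine ⟨f, g, fun h => hg (Ideal.Quotient.eq_zero_iff_mem.2 h), ?_⟩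
  rw [← Ideal.Quotient.eq_zero_iff_mem, map_sub, map_mul, sub_eq_zero]
  rw [hφmk, hφmk] at hfg
  rw [← hfg]
  simp

lemma trdeg_nat (k B : Type) [Field k] [CommRing B] [Algebra k B] [Nontrivial B]
    [Algebra.FiniteType k B] : ∃ t : ℕ, Algebra.trdeg k B = t := by
  have : FaithfulSMul k B :=
    (faithfulSMul_iff_algebraMap_injective k B).2 (algebraMap k B).injective
  obtain ⟨t, ht⟩ := Cardinal.lt_aleph0.1 (trdeg_lt_aleph0_of_finiteType (R := k) (S := B))
  exact ⟨t, ht⟩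

lemma const_of_no_zero {k : Type} [Field k] [IsAlgClosed k] {m : ℕ} (π : MvPolynomial (Fin m) k)
    (w : Fin m → k) (h : ∀ s : k, aeval (fun l => s * w l) π ≠ 0) :
    aeval w π = aeval (0 : Fin m → k) π := by
  let P : Polynomial k := aeval (fun l => Polynomial.C (w l) * Polynomial.X) π
  have hP : ∀ s, P.eval s = aeval (fun l => s * w l) π := by
    intro s
    have := AlgHom.congr_fun (MvPolynomial.comp_aeval
      (f := fun l => Polynomial.C (w l) * Polynomial.X) (φ := Polynomial.aeval s)) π
    rw [AlgHom.comp_apply] at this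
    rw [← Polynomial.coe_aeval_eq_eval]
    refine this.trans ?_
    congr 2
    funext l
    rw [map_mul, Polynomial.aeval_C, Polynomial.aeval_X, mul_comm]
    rfl
  have hdeg : P.degree = 0 := by
    by_contra hd
    obtain ⟨s, hs⟩ := IsAlgClosed.exists_root P hd
    exact h s ((hP s).symm.trans hs)
  rw [Polynomial.eq_C_of_degree_eq_zero hdeg] at hP
  have h1 := hP 1
  have h0 := hP 0
  simp only [Polynomial.eval_C, one_mul, zero_mul] at h1 h0
  rw [← h1, h0]
  rfl

theorem core {k : Type} [Field k] [IsAlgClosed k] [CharZero k] {a m N : ℕ}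
    {Y : Set (Fin m → k)}
    (hcl : ∀ v, (∀ f ∈ vanishingIdeal k Y, aeval v f = 0) → v ∈ Y)
    (hU : UniqDec a Y) (hY : (vanishingIdeal k Y).IsPrime)
    (hcone : ∀ v ∈ Y, ∀ c : k, (fun l => c * v l) ∈ Y)
    (hnz : ∃ v ∈ Y, v ≠ 0)
    (hN : Algebra.trdeg k (MvPolynomial (Fin m) k ⧸ vanishingIdeal k Y) = N)
    (hN3 : 3 ≤ N) (hm : m ≤ a * N) (ha : 2 ≤ a) : False := by
  have hinf : Infinite k := IsAlgClosed.instInfinite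
  obtain ⟨v, hvY, hv0⟩ := hnz
  obtain ⟨l, hl⟩ := Function.ne_iff.1 hv0
  simp only [Pi.zero_apply] at hl
  set B := vanishingIdeal k (prodSet a Y) with hB
  have hBp : B.IsPrime := prodSet_prime ⟨v, hvY⟩ hY
  have hge : ((a * N : ℕ) : Cardinal) ≤
      Algebra.trdeg k (MvPolynomial (Fin a × Fin m) k ⧸ B) := trdeg_prod_ge hN.ge hY
  obtain ⟨tB, htB⟩ := trdeg_nat k (MvPolynomial (Fin a × Fin m) k ⧸ B)
  rw [htB] at hge
  have hge' : a * N ≤ tB := by exact_mod_cast hge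
  obtain ⟨b, rfl⟩ : ∃ b, a = b + 1 := ⟨a - 1, by omega⟩
  have hexp : (b + 1) * N = b * N + N := by ring
  have hNP : NonPar (fun p => Ideal.Quotient.mkₐ k B (X p)) := by
    by_contra hp
    have := trdeg_le_of_par hN.le B le_rfl hp
    rw [htB] at this
    have : tB ≤ 1 + (b + 1 - 1) * N := by exact_mod_cast this
    simp only [Nat.add_sub_cancel] at this
    omega
  obtain ⟨hq1, hq2⟩ := quot_alg hcl hU B le_rfl hNP
  have htA : Algebra.trdeg k (MvPolynomial (Fin m) k) = (m : Cardinal) := by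
    rw [MvPolynomial.trdeg_of_isDomain]
    simp
  have hbot : B.comap (sumHom k (b + 1) m) = ⊥ := by
    by_contra hne
    have h1 := trdeg_quot_lt (k := k) _ hne
    obtain ⟨t, ht⟩ := trdeg_nat k (MvPolynomial (Fin m) k ⧸ B.comap (sumHom k (b + 1) m))
    rw [htA, ht] at h1
    rw [htB, ht] at hq1
    have h1' : t + 1 ≤ m := by exact_mod_cast h1
    have h2' : tB ≤ t := by exact_mod_cast hq1
    omega
  obtain ⟨f, g, hg, hfg⟩ := hq2 l
  rw [hbot, Ideal.mem_bot] at hg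
  obtain ⟨g', f', c', hrel, hc1, hc2⟩ := UniqueFactorizationMonoid.exists_reduced_factors g hg f
  have hc0 : c' ≠ 0 := by
    rintro rfl
    exact hg (by rw [← hc1, zero_mul])
  have hg0 : g' ≠ 0 := by
    rintro rfl
    exact hg (by rw [← hc1, mul_zero])
  have hnot : ∀ h : MvPolynomial (Fin m) k, h ≠ 0 → sumHom k (b + 1) m h ∉ B := by
    intro h hh hmem
    have : h ∈ B.comap (sumHom k (b + 1) m) := hmem
    rw [hbot] at this
    exact hh this
  have hfg' : sumHom k (b + 1) m g' * (∑ i, X (i, l) ^ 2) - sumHom k (b + 1) m f' ∈ B := by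
    have : sumHom k (b + 1) m c' *
        (sumHom k (b + 1) m g' * (∑ i, X (i, l) ^ 2) - sumHom k (b + 1) m f') ∈ B := by
      convert hfg using 1
      rw [← hc1, ← hc2, map_mul, map_mul]
      ring
    exact (hBp.mem_or_mem this).resolve_left (hnot c' hc0)
  have hpt : ∀ y ∈ prodSet (b + 1) Y, aeval (fun l => ∑ i, y (i, l)) g' * ∑ i, y (i, l) ^ 2
      = aeval (fun l => ∑ i, y (i, l)) f' := by
    intro y hy
    have := hfg' y hy
    rw [map_sub, map_mul, aeval_sumHom, aeval_sumHom, sub_eq_zero] at this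
    rw [← this]
    simp
  by_cases hu : IsUnit g'
  · obtain ⟨c, hc, hcg⟩ := MvPolynomial.isUnit_iff_eq_C_of_isReduced.1 hu
    have hcne : c ≠ 0 := hc.ne_zero
    let i0 : Fin (b + 1) := ⟨0, by omega⟩
    let i1 : Fin (b + 1) := ⟨1, by omega⟩
    have hi : i0 ≠ i1 := by simp [i0, i1]
    have key : ∀ e : Fin (b + 1) → k, c * ∑ i, (e i * v l) ^ 2 =
        aeval (fun l => (∑ i, e i) * v l) f' := by
      intro e
      have := hpt (fun p => e p.1 * v p.2) (fun i => hcone v hvY (e i))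
      rw [hcg] at this
      simp only [aeval_C, ← Finset.sum_mul] at this
      exact this
    have k1 := key (Pi.single i0 1 + Pi.single i1 1)
    have k2 := key (Pi.single i0 2)
    have s1 : ∑ i, (Pi.single i0 1 + Pi.single i1 1 : Fin (b + 1) → k) i = 2 := by
      simp [Finset.sum_add_distrib]
      norm_num
    have s2 : ∑ i, (Pi.single i0 2 : Fin (b + 1) → k) i = 2 := by simp
    have s3 : ∑ i, ((Pi.single i0 1 + Pi.single i1 1 : Fin (b + 1) → k) i * v l) ^ 2
        = 2 * v l ^ 2 := by
      have : ∀ i, ((Pi.single i0 1 + Pi.single i1 1 : Fin (b + 1) → k) i * v l) ^ 2 =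
        (Pi.single i0 1 + Pi.single i1 1 : Fin (b + 1) → k) i * v l ^ 2 := by
        intro i
        simp only [Pi.add_apply, Pi.single_apply]
        by_cases h1 : i = i0
        · subst h1
          simp [hi]
        · by_cases h2 : i = i1 <;> simp [h1, h2, hi.symm]
      rw [Finset.sum_congr rfl (fun i _ => this i), ← Finset.sum_mul, s1]
    have s4 : ∑ i, ((Pi.single i0 2 : Fin (b + 1) → k) i * v l) ^ 2
        = 4 * v l ^ 2 := by
      rw [Finset.sum_eq_single i0]
      · simp
        ring
      · intro i _ h
        simp [h]
      · simp
    rw [s1, s3] at k1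
    rw [s2, s4, ← k1] at k2
    have : c * (2 * v l ^ 2) = 0 := by linear_combination k2
    simp [hcne, hl] at this
  · obtain ⟨π, hπ, hπg⟩ := WfDvdMonoid.exists_irreducible_factor hu hg0
    have hπf : ¬ π ∣ f' := fun h => hπ.not_isUnit (hrel hπg h)
    have hπB := hnot π hπ.ne_zero
    have hnu : ¬ IsUnit (Ideal.Quotient.mk B (sumHom k (b + 1) m π)) := by
      intro hun
      obtain ⟨h, hh⟩ := hun.exists_right_inv
      obtain ⟨h, rfl⟩ := Ideal.Quotient.mk_surjective h
      rw [← map_mul, ← map_one (Ideal.Quotient.mk B), Ideal.Quotient.eq] at hh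
      have hnv : ∀ y ∈ prodSet (b + 1) Y, aeval (fun l => ∑ i, y (i, l)) π ≠ 0 := by
        intro y hy h0
        have := hh y hy
        rw [map_sub, map_mul, aeval_sumHom, h0] at this
        simp at this
      have hconst : π - C (aeval (0 : Fin m → k) π) = 0 := by
        by_contra hne
        apply hnot _ hne
        intro y hy
        rw [aeval_sumHom, map_sub, aeval_C, sub_eq_zero]
        refine const_of_no_zero π _ fun s => ?_
        have := hnv (fun p => s * y p) (fun i => hcone _ (hy i) s)
        simpa only [Finset.mul_sum] using this
      rw [sub_eq_zero] at hconst
      apply hπ.not_isUnit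
      have h0 := hπ.ne_zero
      rw [hconst] at h0 ⊢
      have : aeval (0 : Fin m → k) π ≠ 0 := fun h => h0 (by rw [h, C_0])
      exact (IsUnit.mk0 _ this).map C
    have hne0 : Ideal.Quotient.mk B (sumHom k (b + 1) m π) ≠ 0 := fun h =>
      hπB (Ideal.Quotient.eq_zero_iff_mem.1 h)
    obtain ⟨q', hq'p, hq'm, hq't⟩ := exists_prime_codim_one (k := k) _ hne0 hnu
    let q : Ideal (MvPolynomial (Fin (b + 1) × Fin m) k) := q'.comap (Ideal.Quotient.mkₐ k B)
    have hqp : q.IsPrime := inferInstance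
    have hBq : B ≤ q := by
      intro x hx
      change Ideal.Quotient.mk B x ∈ q'
      rw [Ideal.Quotient.eq_zero_iff_mem.2 hx]
      exact q'.zero_mem
    have htq : Algebra.trdeg k ((MvPolynomial (Fin (b + 1) × Fin m) k ⧸ B) ⧸ q') ≤
        Algebra.trdeg k (MvPolynomial (Fin (b + 1) × Fin m) k ⧸ q) := by
      let φ := Ideal.quotientMapₐ q' (Ideal.Quotient.mkₐ k B) (I := q) le_rfl
      have hs : Function.Surjective φ :=
        Ideal.quotientMap_surjective (H := le_rfl) (Ideal.Quotient.mkₐ_surjective k B)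
      have hi : Function.Injective φ := Ideal.quotientMap_injective' (H := le_rfl) le_rfl
      let e := AlgEquiv.ofBijective φ ⟨hi, hs⟩
      exact trdeg_le_of_injective e.symm.toAlgHom e.symm.injective
    obtain ⟨tq', htq'⟩ := trdeg_nat k ((MvPolynomial (Fin (b + 1) × Fin m) k ⧸ B) ⧸ q')
    obtain ⟨tq, htqe⟩ := trdeg_nat k (MvPolynomial (Fin (b + 1) × Fin m) k ⧸ q)
    rw [htq', htqe] at htq
    rw [htB, htq'] at hq't
    have e1 : tq' ≤ tq := by exact_mod_cast htq
    have e2 : tB ≤ tq' + 1 := by exact_mod_cast hq't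
    by_cases hNPq : NonPar (fun p => Ideal.Quotient.mkₐ k q (X p))
    · have h3 := (quot_alg hcl hU q hBq hNPq).1
      set p := q.comap (sumHom k (b + 1) m) with hp
      have hpp : p.IsPrime := inferInstance
      have hπp : (Ideal.span {π}).IsPrime :=
        (Ideal.span_singleton_prime hπ.ne_zero).2 hπ.prime
      have hπmem : π ∈ p := hq'm
      have hfp : f' ∈ p := by
        have h4 := hBq hfg'
        obtain ⟨u, hu⟩ := hπg
        have h5 : sumHom k (b + 1) m g' ∈ q := by
          rw [hu, map_mul]
          exact Ideal.mul_mem_right _ _ hπmem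
        have h6 := Ideal.mul_mem_right (∑ i, X (i, l) ^ 2) q h5
        have := q.sub_mem h6 h4
        rw [sub_sub_cancel] at this
        exact this
      have hlt : Ideal.span {π} < p := by
        refine lt_of_le_of_ne ((Ideal.span_singleton_le_iff_mem _).2 hπmem) ?_
        intro h
        rw [← h] at hfp
        exact hπf (Ideal.mem_span_singleton.1 hfp)
      have h7 := trdeg_quot_lt_quot (k := k) _ _ hlt
      have h8 := trdeg_quot_lt (k := k) (Ideal.span {π}) (by
        rw [Ne, Ideal.span_singleton_eq_bot]; exact hπ.ne_zero)
      obtain ⟨t1, ht1⟩ := trdeg_nat k (MvPolynomial (Fin m) k ⧸ p)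
      obtain ⟨t2, ht2⟩ := trdeg_nat k (MvPolynomial (Fin m) k ⧸ Ideal.span {π})
      rw [ht1, ht2] at h7
      rw [ht2, htA] at h8
      rw [htqe, ht1] at h3
      have e3 : t1 + 1 ≤ t2 := by exact_mod_cast h7
      have e4 : t2 + 1 ≤ m := by exact_mod_cast h8
      have e5 : tq ≤ t1 := by exact_mod_cast h3
      omega
    · have := trdeg_le_of_par hN.le q hBq hNPq
      rw [htqe] at this
      have : tq ≤ 1 + (b + 1 - 1) * N := by exact_mod_cast this
      simp only [Nat.add_sub_cancel] at this
      omega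

/-- The restriction of a polynomial to the line through `v`. -/
def linePoly {k : Type} [Field k] {m : ℕ} (v : Fin m → k) (f : MvPolynomial (Fin m) k) :
    Polynomial k := aeval (fun l => Polynomial.C (v l) * Polynomial.X) f

lemma linePoly_eval {k : Type} [Field k] {m : ℕ} (v : Fin m → k) (f : MvPolynomial (Fin m) k)
    (s : k) : (linePoly v f).eval s = aeval (fun l => s * v l) f := by
  have := AlgHom.congr_fun (MvPolynomial.comp_aeval
    (f := fun l => Polynomial.C (v l) * Polynomial.X) (φ := Polynomial.aeval s)) f
  rw [AlgHom.comp_apply] at this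
  rw [← Polynomial.coe_aeval_eq_eval]
  refine this.trans ?_
  congr 2
  funext l
  rw [map_mul, Polynomial.aeval_C, Polynomial.aeval_X, mul_comm]
  rfl

lemma linePoly_homog {k : Type} [Field k] {m d : ℕ} (v : Fin m → k) (f : MvPolynomial (Fin m) k)
    (hf : f.IsHomogeneous d) :
    linePoly v f = Polynomial.C (aeval v f) * Polynomial.X ^ d := by
  have h1 : linePoly v f = ∑ s ∈ f.support,
      Polynomial.C (coeff s f * ∏ i, v i ^ s i) * Polynomial.X ^ d := by
    rw [linePoly, MvPolynomial.aeval_def, MvPolynomial.eval₂_eq']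
    refine Finset.sum_congr rfl fun s hs => ?_
    have hd := hf.degree_eq_sum_deg_support hs
    have hd' : ∑ i, s i = d := by
      rw [hd]
      exact (Finset.sum_subset (Finset.subset_univ _) (by simp)).symm
    simp only [mul_pow, Finset.prod_mul_distrib, Finset.prod_pow_eq_pow_sum, hd', map_mul, map_prod,
      map_pow, Polynomial.algebraMap_eq]
    ring
  rw [h1, MvPolynomial.aeval_def, MvPolynomial.eval₂_eq', ← Finset.sum_mul, map_sum]
  rfl

lemma linePoly_coeff {k : Type} [Field k] {m : ℕ} (v : Fin m → k) (f : MvPolynomial (Fin m) k)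
    (d : ℕ) : (linePoly v f).coeff d = aeval v (homogeneousComponent d f) := by
  have h : linePoly v f = ∑ i ∈ Finset.range (f.totalDegree + 1),
      Polynomial.C (aeval v (homogeneousComponent i f)) * Polynomial.X ^ i := by
    conv_lhs => rw [← sum_homogeneousComponent f, linePoly, map_sum]
    exact Finset.sum_congr rfl fun i _ =>
      linePoly_homog v _ (homogeneousComponent_isHomogeneous i f)
  rw [h, Polynomial.finsetSum_coeff]
  simp only [Polynomial.coeff_C_mul_X_pow, Finset.sum_ite_eq, Finset.mem_range]
  split_ifs with h1
  · rfl
  · rw [homogeneousComponent_eq_zero _ _ (by omega), map_zero]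

lemma comp_vanish {k : Type} [Field k] [Infinite k] {m : ℕ} (v : Fin m → k)
    (f : MvPolynomial (Fin m) k) (h : ∀ s : k, s ≠ 0 → aeval (fun l => s * v l) f = 0) (d : ℕ) :
    aeval v (homogeneousComponent d f) = 0 := by
  rw [← linePoly_coeff]
  have : linePoly v f = 0 := by
    apply Polynomial.eq_zero_of_infinite_isRoot
    refine Set.Infinite.mono (s := {0}ᶜ) ?_ (Set.finite_singleton 0).infinite_compl
    intro s hs
    exact (linePoly_eval v f s).trans (h s hs)
  rw [this, Polynomial.coeff_zero]

lemma homog_smul {k : Type} [Field k] {m d : ℕ} (v : Fin m → k) (f : MvPolynomial (Fin m) k)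
    (hf : f.IsHomogeneous d) (s : k) : aeval (fun l => s * v l) f = aeval v f * s ^ d := by
  rw [← linePoly_eval, linePoly_homog v f hf]
  simp

lemma mem_zeros {k : Type} [Field k] {m d : ℕ} (f : MvPolynomial (Fin m) k)
    (hf : f.IsHomogeneous d) (v : Fin m → k) (hv : v ≠ 0) :
    Projectivization.mk k v hv ∈ zeros k f ↔ aeval v f = 0 := by
  constructor
  · intro h
    exact h v hv rfl
  · intro h w hw he
    rw [Projectivization.mk_eq_mk_iff'] at he
    obtain ⟨c, rfl⟩ := he
    have := homog_smul v f hf c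
    rw [h, zero_mul] at this
    exact this

/-- The affine cone. -/
def cone {k : Type} [Field k] {m : ℕ} (C : Set (PS k m)) : Set (Fin m → k) :=
  {v | ∀ hv : v ≠ 0, Projectivization.mk k v hv ∈ C}

lemma cone_smul {k : Type} [Field k] {m : ℕ} (C : Set (PS k m)) (v : Fin m → k) (hv : v ∈ cone C)
    (c : k) : (fun l => c * v l) ∈ cone C := by
  intro h
  have hv0 : v ≠ 0 := by
    rintro rfl
    apply h
    funext l
    simp
  convert hv hv0 using 1
  rw [Projectivization.mk_eq_mk_iff']
  exact ⟨c, rfl⟩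

lemma rep_mem_cone {k : Type} [Field k] {m : ℕ} (C : Set (PS k m)) (p : PS k m) :
    p.rep ∈ cone C ↔ p ∈ C := by
  constructor
  · intro h
    have := h p.rep_nonzero
    rwa [Projectivization.mk_rep] at this
  · intro h hv
    rwa [Projectivization.mk_rep]

lemma mem_van_of_homog {k : Type} [Field k] {m d : ℕ} (C : Set (PS k m)) (hne : C.Nonempty)
    (f : MvPolynomial (Fin m) k) (hf : f.IsHomogeneous d) (h : C ⊆ zeros k f) :
    f ∈ vanishingIdeal k (cone C) := by
  intro v hv
  by_cases hv0 : v = 0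
  · obtain ⟨p, hp⟩ := hne
    have h1 : aeval p.rep f = 0 := h hp p.rep p.rep_nonzero p.mk_rep
    have h2 := homog_smul p.rep f hf 0
    rw [h1, zero_mul] at h2
    rw [hv0, ← h2]
    congr 2
    funext l
    simp
  · exact (mem_zeros f hf v hv0).1 (h (hv hv0))

lemma cone_closed {k : Type} [Field k] {m : ℕ} (C : Set (PS k m)) (hne : C.Nonempty)
    (hC : IsZClosed k C) (v : Fin m → k) (h : ∀ f ∈ vanishingIdeal k (cone C), aeval v f = 0) :
    v ∈ cone C := by
  obtain ⟨F, hF, hCF⟩ := hC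
  intro hv
  rw [hCF]
  simp only [Set.mem_iInter]
  intro f hf
  obtain ⟨d, hd⟩ := hF f hf
  rw [mem_zeros f hd v hv]
  refine h f (mem_van_of_homog C hne f hd ?_)
  rw [hCF]
  exact Set.biInter_subset_of_mem hf

lemma exists_comp {k : Type} [Field k] {m : ℕ} (C : Set (PS k m)) (hne : C.Nonempty)
    (f : MvPolynomial (Fin m) k) (hf : f ∉ vanishingIdeal k (cone C)) :
    ∃ d, ¬ C ⊆ zeros k (homogeneousComponent d f) := by
  by_contra hcon
  push Not at hcon
  apply hf
  rw [← sum_homogeneousComponent f]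
  exact Ideal.sum_mem _ fun i _ =>
    mem_van_of_homog C hne _ (homogeneousComponent_isHomogeneous i f) (hcon i)

lemma zeros_closed {k : Type} [Field k] {m d : ℕ} (f : MvPolynomial (Fin m) k)
    (hf : f.IsHomogeneous d) : IsZClosed k (zeros k f) :=
  ⟨{f}, by simpa using ⟨d, hf⟩, by simp⟩

lemma cone_prime {k : Type} [Field k] [Infinite k] {m : ℕ} (C : Set (PS k m))
    (hC : IsIrredClosed k C) : (vanishingIdeal k (cone C)).IsPrime := by
  obtain ⟨hne, hcl, hirr⟩ := hC
  refine ⟨?_, ?_⟩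
  · rw [Ideal.ne_top_iff_one]
    intro h
    obtain ⟨p, hp⟩ := hne
    have := h p.rep ((rep_mem_cone C p).2 hp)
    simp at this
  · intro f g hfg
    by_contra hcon
    push Not at hcon
    obtain ⟨d, hd⟩ := exists_comp C hne f hcon.1
    obtain ⟨e, he⟩ := exists_comp C hne g hcon.2
    have h1 : ¬ C ⊆ zeros k (homogeneousComponent d f) ∪ zeros k (homogeneousComponent e g) := by
      intro h
      rcases hirr _ _ (zeros_closed _ (homogeneousComponent_isHomogeneous d f))
        (zeros_closed _ (homogeneousComponent_isHomogeneous e g)) h with h | h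
      · exact hd h
      · exact he h
    obtain ⟨p, hpC, hp⟩ := Set.not_subset.1 h1
    rw [Set.mem_union, not_or] at hp
    rw [← p.mk_rep, mem_zeros _ (homogeneousComponent_isHomogeneous d f),
      mem_zeros _ (homogeneousComponent_isHomogeneous e g)] at hp
    rw [← linePoly_coeff, ← linePoly_coeff] at hp
    have hf0 : linePoly p.rep f ≠ 0 := fun h => hp.1 (by rw [h, Polynomial.coeff_zero])
    have hg0 : linePoly p.rep g ≠ 0 := fun h => hp.2 (by rw [h, Polynomial.coeff_zero])
    apply mul_ne_zero hf0 hg0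
    apply Polynomial.funext
    intro s
    rw [Polynomial.eval_mul, linePoly_eval, linePoly_eval, ← map_mul, Polynomial.eval_zero]
    exact hfg _ (cone_smul C _ ((rep_mem_cone C p).2 hpC) s)

lemma cone_lt {k : Type} [Field k] {m : ℕ} (C C' : Set (PS k m)) (hne : C.Nonempty)
    (hC : IsZClosed k C) (h : C ⊂ C') :
    vanishingIdeal k (cone C') < vanishingIdeal k (cone C) := by
  refine lt_of_le_of_ne (vanishingIdeal_anti_mono fun v hv h0 => h.subset (hv h0)) ?_
  intro he
  obtain ⟨p, hp, hpC⟩ := Set.exists_of_ssubset h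
  apply hpC
  rw [← rep_mem_cone]
  apply cone_closed C hne hC
  intro f hf
  rw [← he] at hf
  exact hf _ ((rep_mem_cone C' p).2 hp)

lemma cone_trdeg {k : Type} [Field k] [Infinite k] {m n : ℕ} (X : Set (PS k m))
    (hX : IsIrredClosed k X) (hn : 0 < n) (hdim : zdim k X = n) :
    ((n + 1 : ℕ) : Cardinal) ≤
      Algebra.trdeg k (MvPolynomial (Fin m) k ⧸ vanishingIdeal k (cone X)) := by
  rw [zdim] at hdim
  obtain ⟨C, hC, hlt⟩ := hdim ▸ Nat.sSup_mem (s := {m_1 | ∃ C : Fin (m_1 + 1) → Set (PS k m),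
    (∀ i, IsIrredClosed k (C i) ∧ C i ⊆ X) ∧
    ∀ i j : Fin (m_1 + 1), i < j → C i ⊂ C j}) (by
      by_contra hne
      rw [Set.not_nonempty_iff_eq_empty] at hne
      rw [hne] at hdim
      simp at hdim
      omega) (by
      by_contra hb
      rw [Nat.sSup_of_not_bddAbove hb] at hdim
      omega)
  have hpr : ∀ i, (vanishingIdeal k (cone (C i))).IsPrime := fun i => cone_prime _ (hC i).1
  have key : ∀ i (hi : i < n + 1), ((i + 1 : ℕ) : Cardinal) ≤
      Algebra.trdeg k (MvPolynomial (Fin m) k ⧸ vanishingIdeal k (cone (C ⟨i, hi⟩))) := by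
    intro i
    induction i with
    | zero =>
      intro hi
      obtain ⟨p, hp⟩ := (hC ⟨0, hi⟩).1.1
      have hlt : vanishingIdeal k (cone (C ⟨0, hi⟩)) < vanishingIdeal k {(0 : Fin m → k)} := by
        refine lt_of_le_of_ne (vanishingIdeal_anti_mono ?_) ?_
        · intro v hv h0
          exact absurd hv h0
        · intro he
          apply p.rep_nonzero
          funext l
          have h1 : (MvPolynomial.X l : MvPolynomial (Fin m) k) ∈
              vanishingIdeal k {(0 : Fin m → k)} := by
            rw [mem_vanishingIdeal_singleton_iff]
            simp
          rw [← he] at h1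
          have := h1 p.rep ((rep_mem_cone _ p).2 hp)
          simpa using this
      have := hpr ⟨0, hi⟩
      have h2 := trdeg_quot_lt_quot (k := k) _ _ hlt
      refine le_trans ?_ h2
      simp
    | succ i ih =>
      intro hi
      have hi' : i < n + 1 := by omega
      have h1 := ih hi'
      have := hpr ⟨i, hi'⟩
      have := hpr ⟨i + 1, hi⟩
      have h2 := trdeg_quot_lt_quot (k := k) _ _
        (cone_lt _ _ (hC ⟨i, hi'⟩).1.1 (hC ⟨i, hi'⟩).1.2.1
          (hlt ⟨i, hi'⟩ ⟨i + 1, hi⟩ (by simp)))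
      refine le_trans ?_ h2
      push_cast
      gcongr
      exact_mod_cast h1
  refine (key n (by omega)).trans ?_
  have := cone_prime X hX
  have := hpr ⟨n, by omega⟩
  rcases (hC ⟨n, by omega⟩).2.eq_or_ssubset with h | h
  · rw [h]
  · exact le_self_add.trans (trdeg_quot_lt_quot (k := k) _ _
      (cone_lt _ _ (hC ⟨n, by omega⟩).1.1 (hC ⟨n, by omega⟩).1.2.1 h))

lemma hVanish_vanish {k : Type} [Field k] {m : ℕ} (S : Set (PS k m)) (f : MvPolynomial (Fin m) k)
    (hf : f ∈ hVanish k S) (v : Fin m → k) (hv0 : v ≠ 0) (hv : Projectivization.mk k v hv0 ∈ S) :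
    aeval v f = 0 := by
  have h : hVanish k S ≤ vanishingIdeal k {v} := by
    rw [hVanish, Ideal.span_le]
    rintro g ⟨_, hg⟩
    rw [SetLike.mem_coe, mem_vanishingIdeal_singleton_iff]
    exact hg hv v hv0 rfl
  exact h hf v rfl

lemma mem_hVanish_iff {k : Type} [Field k] {m d : ℕ} (S : Set (PS k m))
    (f : MvPolynomial (Fin m) k) (hf : f.IsHomogeneous d) :
    f ∈ hVanish k S ↔ ∀ p ∈ S, aeval p.rep f = 0 := by
  constructor
  · intro h p hp
    exact hVanish_vanish S f h p.rep p.rep_nonzero (by rwa [Projectivization.mk_rep])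
  · intro h
    refine Ideal.subset_span ⟨⟨d, hf⟩, fun p hp => ?_⟩
    rw [← p.mk_rep, mem_zeros f hf]
    exact h p hp

lemma hVanish_homog {k : Type} [Field k] [Infinite k] {m : ℕ} (S : Set (PS k m)) :
    IsHomogIdeal k (hVanish k S) := by
  intro f hf d
  rw [mem_hVanish_iff S _ (homogeneousComponent_isHomogeneous d f)]
  intro p hp
  refine comp_vanish p.rep f (fun s hs => ?_) d
  have hne : (fun l => s * p.rep l) ≠ 0 := by
    have := smul_ne_zero hs p.rep_nonzero
    exact this
  refine hVanish_vanish S f hf _ hne ?_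
  have he : Projectivization.mk k _ hne = Projectivization.mk k p.rep p.rep_nonzero := by
    rw [Projectivization.mk_eq_mk_iff']
    exact ⟨s, rfl⟩
  rw [he, p.mk_rep]
  exact hp

/-- Evaluation at the points of a finite set. -/
def evT {k : Type} [Field k] {m : ℕ} (T : Finset (PS k m)) :
    MvPolynomial (Fin m) k →ₗ[k] (T → k) :=
  LinearMap.pi fun p => (aeval p.1.rep).toLinearMap

lemma exists_sep {k : Type} [Field k] {m : ℕ} (p q : PS k m) (h : p ≠ q) :
    ∃ f : MvPolynomial (Fin m) k, f.IsHomogeneous 1 ∧ aeval q.rep f = 0 ∧ aeval p.rep f ≠ 0 := by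
  by_contra hcon
  push Not at hcon
  apply h
  obtain ⟨j, hj⟩ := Function.ne_iff.1 q.rep_nonzero
  simp only [Pi.zero_apply] at hj
  rw [← p.mk_rep, ← q.mk_rep, Projectivization.mk_eq_mk_iff']
  refine ⟨p.rep j / q.rep j, ?_⟩
  funext i
  have := hcon (C (q.rep j) * X i - C (q.rep i) * X j)
    ((isHomogeneous_C_mul_X _ _).sub (isHomogeneous_C_mul_X _ _)) (by simp [mul_comm])
  simp only [map_sub, map_mul, aeval_C, aeval_X, Algebra.algebraMap_self, RingHom.id_apply] at this
  simp only [Pi.smul_apply, smul_eq_mul]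
  field_simp
  linear_combination -this

lemma evT_surj {k : Type} [Field k] {m : ℕ} (T : Finset (PS k m)) (d : ℕ) (hd : T.card ≤ d) :
    Submodule.map (evT T) (homogeneousSubmodule (Fin m) k d) = ⊤ := by
  classical
  rw [eq_top_iff, ← (Pi.basisFun k T).span_eq, Submodule.span_le]
  rintro _ ⟨p, rfl⟩
  rw [Pi.basisFun_apply]
  have hsep : ∀ q : PS k m, ∃ f : MvPolynomial (Fin m) k, f.IsHomogeneous 1 ∧
      (q ≠ p.1 → aeval q.rep f = 0) ∧ aeval p.1.rep f ≠ 0 := by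
    intro q
    by_cases h : q = p.1
    · obtain ⟨j, hj⟩ := Function.ne_iff.1 p.1.rep_nonzero
      exact ⟨X j, isHomogeneous_X _ _, fun h' => absurd h h', by simpa using hj⟩
    · obtain ⟨f, h1, h2, h3⟩ := exists_sep p.1 q (Ne.symm h)
      exact ⟨f, h1, fun _ => h2, h3⟩
  choose L hL1 hL2 hL3 using hsep
  obtain ⟨j, hj⟩ := Function.ne_iff.1 p.1.rep_nonzero
  simp only [Pi.zero_apply] at hj
  let F : MvPolynomial (Fin m) k := (∏ q ∈ T, L q) * X j ^ (d - T.card)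
  have hF : F.IsHomogeneous d := by
    have h1 := IsHomogeneous.prod T L (fun _ => 1) (fun q _ => hL1 q)
    have h2 := h1.mul (isHomogeneous_X_pow (R := k) j (d - T.card))
    simp only [Finset.sum_const, smul_eq_mul, mul_one] at h2
    rwa [Nat.add_sub_cancel' hd] at h2
  have hFp : aeval p.1.rep F ≠ 0 := by
    simp only [F, map_mul, map_prod, map_pow, aeval_X]
    exact mul_ne_zero (Finset.prod_ne_zero_iff.2 fun q _ => hL3 q) (pow_ne_zero _ hj)
  have hFq : ∀ q ∈ T, q ≠ p.1 → aeval q.rep F = 0 := by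
    intro q hq hqp
    simp only [F, map_mul, map_prod]
    rw [Finset.prod_eq_zero hq (hL2 q hqp), zero_mul]
  refine ⟨(aeval p.1.rep F)⁻¹ • F, Submodule.smul_mem _ _ hF, ?_⟩
  rw [map_smul]
  funext q
  simp only [evT, Pi.smul_apply, LinearMap.pi_apply, AlgHom.toLinearMap_apply, smul_eq_mul]
  by_cases h : q = p
  · subst h
    rw [inv_mul_cancel₀ hFp, Pi.single_eq_same]
  · rw [hFq q.1 q.2 (fun h' => h (Subtype.ext h')), Pi.single_eq_of_ne h, mul_zero]

lemma hVanish_deg {k : Type} [Field k] {m : ℕ} (T : Finset (PS k m)) :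
    SchemeDeg k (hVanish k (T : Set (PS k m))) T.card := by
  refine ⟨T.card, fun d hd => ?_⟩
  rw [hilb]
  set M := (Ideal.Quotient.mkₐ k (hVanish k (T : Set (PS k m)))).toLinearMap with hM
  set H := homogeneousSubmodule (Fin m) k d with hH
  have hker : LinearMap.ker (M.domRestrict H) = LinearMap.ker ((evT T).domRestrict H) := by
    ext ⟨f, hf⟩
    have h1 : M.domRestrict H ⟨f, hf⟩ = 0 ↔ f ∈ hVanish k (T : Set (PS k m)) :=
      Ideal.Quotient.eq_zero_iff_mem
    rw [LinearMap.mem_ker, LinearMap.mem_ker, h1, mem_hVanish_iff _ f hf]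
    constructor
    · intro h
      funext p
      exact h p.1 p.2
    · intro h p hp
      exact congrFun h ⟨p, hp⟩
  have h1 := (M.domRestrict H).quotKerEquivRange.finrank_eq
  have h2 := ((evT T).domRestrict H).quotKerEquivRange.finrank_eq
  rw [hker, h2, LinearMap.range_domRestrict, LinearMap.range_domRestrict, evT_surj T d hd,
    finrank_top] at h1
  rw [← h1]
  simp

/-- The linear form with given coefficients. -/
def linForm (k : Type) [Field k] (m : ℕ) : (Fin m → k) →ₗ[k] MvPolynomial (Fin m) k :=
  Fintype.linearCombination k (fun i => (X i : MvPolynomial (Fin m) k))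

lemma linForm_aeval {k : Type} [Field k] {m : ℕ} (c v : Fin m → k) :
    aeval v (linForm k m c) = ∑ i, c i * v i := by
  simp [linForm, Fintype.linearCombination_apply]

lemma linForm_inj {k : Type} [Field k] {m : ℕ} : Function.Injective (linForm k m) := by
  classical
  intro c c' h
  funext i
  have := congrArg (aeval (Pi.single i 1 : Fin m → k)) h
  simpa [linForm_aeval, Pi.single_apply] using this

lemma linForm_range {k : Type} [Field k] {m : ℕ} :
    LinearMap.range (linForm k m) = homogeneousSubmodule (Fin m) k 1 := by
  rw [linForm, Fintype.range_linearCombination, homogeneousSubmodule_one_eq_span_X]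

lemma indep_of_scheme {k : Type} [Field k] {m : ℕ} (T : Finset (PS k m)) (hT : T.card ≤ m)
    (h : SchemeLinIndep k (hVanish k (T : Set (PS k m))) T.card) :
    LinearIndependent k (fun p : T => p.1.rep) := by
  classical
  let M : (Fin m → k) →ₗ[k] (T → k) := (evT T).comp (linForm k m)
  have hMa : ∀ c p, M c p = ∑ i, c i * p.1.rep i := fun c p => linForm_aeval c p.1.rep
  have hdeg : degOnePart k (hVanish k (T : Set (PS k m))) =
      Submodule.map (linForm k m) (LinearMap.ker M) := by
    ext f
    constructor
    · rintro ⟨hf1, hf2⟩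
      have hf1' : f ∈ LinearMap.range (linForm k m) := by rw [linForm_range]; exact hf1
      obtain ⟨c, rfl⟩ := hf1'
      refine ⟨c, ?_, rfl⟩
      rw [SetLike.mem_coe, LinearMap.mem_ker]
      funext p
      exact (mem_hVanish_iff _ _ hf1).1 hf2 p.1 p.2
    · rintro ⟨c, hc, rfl⟩
      have h1 : linForm k m c ∈ homogeneousSubmodule (Fin m) k 1 := by
        rw [← linForm_range]
        exact ⟨c, rfl⟩
      refine ⟨h1, (mem_hVanish_iff _ _ h1).2 fun p hp => ?_⟩
      exact congrFun (LinearMap.mem_ker.1 hc) ⟨p, hp⟩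
  rw [SchemeLinIndep, hdeg,
    (Submodule.equivMapOfInjective (linForm k m) linForm_inj (LinearMap.ker M)).symm.finrank_eq]
    at h
  have hrn := LinearMap.finrank_range_add_finrank_ker M
  rw [h, Module.finrank_fin_fun] at hrn
  have hsurj : LinearMap.range M = ⊤ := by
    apply Submodule.eq_top_of_finrank_eq
    simp
    omega
  rw [Fintype.linearIndependent_iff]
  intro g hg p
  have hmem : (Pi.single p 1 : T → k) ∈ LinearMap.range M := by rw [hsurj]; trivial
  obtain ⟨c, hc⟩ := hmem
  have h1 : ∑ q : T, g q * M c q = 0 := by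
    simp only [hMa, Finset.mul_sum]
    rw [Finset.sum_comm]
    apply Finset.sum_eq_zero
    intro i _
    have := congrFun hg i
    simp only [Finset.sum_apply, Pi.smul_apply, smul_eq_mul, Pi.zero_apply] at this
    calc ∑ q : T, g q * (c i * q.1.rep i) = c i * ∑ q : T, g q * q.1.rep i := by
          rw [Finset.mul_sum]
          exact Finset.sum_congr rfl fun q _ => by ring
      _ = 0 := by rw [this, mul_zero]
  rw [hc] at h1
  simpa [Pi.single_apply] using h1

lemma indep_of_rho {k : Type} [Field k] [Infinite k] {m t : ℕ} (X : Set (PS k m)) (ht : 0 < t)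
    (htm : t ≤ m) (hrho : t ≤ rho'' k X) (T : Finset (PS k m)) (hTX : (T : Set (PS k m)) ⊆ X)
    (hT : T.card ≤ t) : LinearIndependent k (fun p : T => p.1.rep) := by
  apply indep_of_scheme T (hT.trans htm)
  rw [rho''] at hrho
  set s := {t | 0 < t ∧ ∀ (I : Ideal (MvPolynomial (Fin m) k)) (d : ℕ),
    IsHomogIdeal k I → SubschemeOf k X I → SchemeDeg k I d → SmoothableIn k X I d →
    d ≤ t → SchemeLinIndep k I d} with hs
  have hmem : sSup s ∈ s := by
    apply Nat.sSup_mem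
    · by_contra hne
      rw [Set.not_nonempty_iff_eq_empty] at hne
      rw [hne] at hrho
      simp at hrho
      omega
    · by_contra hb
      rw [Nat.sSup_of_not_bddAbove hb] at hrho
      omega
  refine hmem.2 _ _ (hVanish_homog _) ?_ (hVanish_deg T) (Or.inl ⟨T, hTX, rfl, rfl⟩)
    (hT.trans hrho)
  refine Ideal.span_mono ?_
  rintro f ⟨h1, h2⟩
  exact ⟨h1, hTX.trans h2⟩

lemma uniqDec_cone {k : Type} [Field k] {m a : ℕ} (X : Set (PS k m)) (ha : 2 ≤ a)
    (H : ∀ T : Finset (PS k m), (T : Set (PS k m)) ⊆ X → T.card ≤ 2 * a →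
      LinearIndependent k (fun p : T => p.1.rep)) : UniqDec a (cone X) := by
  classical
  have dec : ∀ y ∈ prodSet a (cone X), NonPar y → ∃ (P : Fin a → PS k m) (c : Fin a → k),
      Function.Injective P ∧ (∀ i, P i ∈ X) ∧ (∀ i, c i ≠ 0) ∧
      ∀ i l, y (i, l) = c i * (P i).rep l := by
    intro y hy hN
    have hne : ∀ i, (fun l => y (i, l)) ≠ 0 := by
      intro i h0
      have hj : ∃ j : Fin a, i ≠ j := by
        have : Nontrivial (Fin a) := Fin.nontrivial_iff_two_le.2 ha
        obtain ⟨j, hj⟩ := exists_ne i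
        exact ⟨j, hj.symm⟩
      obtain ⟨j, hj⟩ := hj
      obtain ⟨l, l', hl⟩ := hN i j hj
      have h1 := congrFun h0 l
      have h2 := congrFun h0 l'
      simp only [Pi.zero_apply] at h1 h2
      rw [h1, h2, zero_mul, zero_mul] at hl
      exact hl rfl
    have hc : ∀ i, ∃ c : k, c ≠ 0 ∧
        ∀ l, y (i, l) = c * (Projectivization.mk k _ (hne i)).rep l := by
      intro i
      obtain ⟨u, hu⟩ := Projectivization.exists_smul_eq_mk_rep k _ (hne i)
      refine ⟨(u⁻¹ : kˣ), Units.ne_zero _, fun l => ?_⟩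
      rw [← hu]
      simp [Units.smul_def]
    choose c hc0 hc using hc
    refine ⟨fun i => Projectivization.mk k _ (hne i), c, ?_, fun i => hy i (hne i), hc0, hc⟩
    intro i j hij
    by_contra hne'
    obtain ⟨l, l', hl⟩ := hN i j hne'
    apply hl
    simp only at hij
    rw [hc i l, hc j l', hc i l', hc j l, hij]
    ring
  intro y hy y' hy' hN hN' hsum
  obtain ⟨P, c, hPi, hPX, hc0, hc⟩ := dec y hy hN
  obtain ⟨P', c', hPi', hPX', hc0', hc'⟩ := dec y' hy' hN'
  let T : Finset (PS k m) := Finset.univ.image P ∪ Finset.univ.image P'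
  have hTX : (T : Set (PS k m)) ⊆ X := by
    intro p hp
    simp only [T, Finset.coe_union, Finset.coe_image, Finset.coe_univ, Set.image_univ] at hp
    rcases hp with ⟨i, rfl⟩ | ⟨i, rfl⟩
    · exact hPX i
    · exact hPX' i
  have hTc : T.card ≤ 2 * a := by
    refine (Finset.card_union_le _ _).trans ?_
    have h1 := Finset.card_image_le (s := Finset.univ) (f := P)
    have h2 := Finset.card_image_le (s := Finset.univ) (f := P')
    simp only [Finset.card_univ, Fintype.card_fin] at h1 h2
    omega
  have hli := H T hTX hTc
  have hPT : ∀ i, P i ∈ T := fun i =>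
    Finset.mem_union_left _ (Finset.mem_image_of_mem _ (Finset.mem_univ i))
  have hPT' : ∀ i, P' i ∈ T := fun i =>
    Finset.mem_union_right _ (Finset.mem_image_of_mem _ (Finset.mem_univ i))
  let F : T →₀ k := ∑ i, Finsupp.single ⟨P i, hPT i⟩ (c i)
  let F' : T →₀ k := ∑ i, Finsupp.single ⟨P' i, hPT' i⟩ (c' i)
  have hFF : F = F' := by
    apply hli
    simp only [F, F', map_sum, Finsupp.linearCombination_single]
    funext l
    have := hsum l
    simp only [hc, hc'] at this
    simpa using this
  have hFe : ∀ p, F p = ∑ i, if P i = p.1 then c i else 0 := by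
    intro p
    simp only [F, Finsupp.finsetSum_apply, Finsupp.single_apply, Subtype.ext_iff]
  have hFe' : ∀ p, F' p = ∑ i, if P' i = p.1 then c' i else 0 := by
    intro p
    simp only [F', Finsupp.finsetSum_apply, Finsupp.single_apply, Subtype.ext_iff]
  have hF : ∀ i, F ⟨P i, hPT i⟩ = c i := by
    intro i
    rw [hFe]
    simp [hPi.eq_iff]
  have hF' : ∀ i, F' ⟨P' i, hPT' i⟩ = c' i := by
    intro i
    rw [hFe']
    simp [hPi'.eq_iff]
  have hex : ∀ j, ∃ i, P i = P' j := by
    intro j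
    by_contra hcon
    push Not at hcon
    apply hc0' j
    rw [← hF' j, ← hFF, hFe]
    exact Finset.sum_eq_zero fun i _ => if_neg (hcon i)
  choose σ hσ using hex
  have hσi : Function.Injective σ := by
    intro i j hij
    apply hPi'
    rw [← hσ, ← hσ, hij]
  refine ⟨Equiv.ofBijective σ (Finite.injective_iff_bijective.1 hσi), fun i l => ?_⟩
  rw [Equiv.ofBijective_apply, hc, hc', hσ]
  congr 1
  rw [← hF' i, ← hFF, ← hF (σ i)]
  congr 1
  exact Subtype.ext (hσ i).symm

theorem final {k : Type} [Field k] [IsAlgClosed k] [CharZero k] (r n a : ℕ) (hn : 2 ≤ n)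
    (X : Set (PS k (r + 1))) (hX : IsIrredClosed k X) (hdim : zdim k X = n)
    (hdiv : r + 1 = a * (n + 1)) (ha : 2 ≤ a) (hrho : 2 * a ≤ rho'' k X) : False := by
  have hinf : Infinite k := IsAlgClosed.instInfinite
  have h2a : 2 * a ≤ r + 1 := by
    rw [hdiv]
    nlinarith
  have hU : UniqDec a (cone X) := uniqDec_cone X ha
    (fun T hT hTc => indep_of_rho X (by omega) h2a hrho T hT hTc)
  have hpr := cone_prime X hX
  obtain ⟨N, hN⟩ := trdeg_nat k (MvPolynomial (Fin (r + 1)) k ⧸ vanishingIdeal k (cone X))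
  have hge := cone_trdeg X hX (by omega) hdim
  rw [hN] at hge
  have hge' : n + 1 ≤ N := by exact_mod_cast hge
  obtain ⟨p, hp⟩ := hX.1
  refine core (cone_closed X hX.1 hX.2.1) hU hpr (fun v hv c => cone_smul X v hv c)
    ⟨p.rep, (rep_mem_cone X p).2 hp, p.rep_nonzero⟩ hN (by omega) ?_ ha
  rw [hdiv]
  exact Nat.mul_le_mul_left a hge'

/-- `X ⊆ ℙ^r` of dimension `n ≥ 2`, `ρ''(X) ≥ 2a` with
`a = (r+1)/(n+1) ∈ ℤ`, `a ≥ 2`; `S ⊆ X` a general set of `a−1` smooth points,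
`V = ⟨∪_{p∈S} T_pX⟩` of (affine-cone) dimension `(a−1)(n+1)`.  Then (i) no `o ∈ X ∖ S` lies
in `V`, and (ii) the projection from `V` is injective on `X ∖ S`. -/
theorem statement16 [IsAlgClosed K] [CharZero K] (r n a : ℕ) (hn : 2 ≤ n)
    (X : Set (PS K (r + 1))) (hX : IsVariety K X) (hdim : zdim K X = n)
    (hdiv : r + 1 = a * (n + 1)) (ha : 2 ≤ a) (hrho : 2 * a ≤ rho'' K X)
    (S : Finset (PS K (r + 1))) (hScard : S.card = a - 1)
    (hSsm : ∀ p ∈ S, SmoothAt K X p)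
    (V : Submodule K (Fin (r + 1) → K)) (hV : V = ⨆ p ∈ S, tangentSub K X p)
    (hVdim : Module.finrank K V = (a - 1) * (n + 1)) :
    (∀ o : PS K (r + 1), o ∈ X → o ∉ (S : Set (PS K (r + 1))) → o.rep ∉ V) ∧
    (∀ o o' : PS K (r + 1), o ∈ X → o' ∈ X → o ∉ (S : Set (PS K (r + 1))) →
      o' ∉ (S : Set (PS K (r + 1))) → o ≠ o' →
        o'.rep ∉ V ⊔ Submodule.span K {o.rep}) :=
  (final r n a hn X hX.1 hdim hdiv ha hrho).elim

end Dep
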